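/- Let d ≥ 2, let Δ be a (d-1)-dimensional simplicial complex, and let N(d) be the number of vertices of sd^3(Δ_{d-1}) that do not lie on the boundary of sd^3(Δ_{d-1}) (i.e. that are not vertices of the 3-fold barycentric subdivision of the boundary complex of Δ_{d-1}). Then for every r ≥ 3 one has β_{i,i+j}(K[sd^r(Δ)]) ≠ 0 in each of the following cases: (i) 1 ≤ j ≤ d/2 and j ≤ i ≤ pdim(K[sd^r(Δ)]) + depth(K[Δ]) - N(d) + 2^d - d - 1 - m_{d-j-1}(d); (ii) d/2 < j ≤ d-2 and m_j(d) ≤ i ≤ pdim(K[sd^r(Δ)]) + depth(K[Δ]) - N(d) + 2^d - 2d + j; (iii) j = d-1 and 2^d - d - 1 ≤ i ≤ pdim(K[sd^r(Δ)]) + depth(K[Δ]) - N(d) + 2^d - d - 1. -/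

import Mathlib

open Finset BigOperators

noncomputable section
open scoped Classical

/-- A finite abstract simplicial complex on (a finite subset of) `ℕ`,
given as its finite set of faces. -/
abbrev SC := Finset (Finset ℕ)

/-- `Δ` is a simplicial complex: it is closed under taking subsets of faces. -/
def IsComplex {α : Type*} [DecidableEq α] (Δ : Finset (Finset α)) : Prop :=
  ∀ s ∈ Δ, ∀ t ⊆ s, t ∈ Δ

/-- The vertex set (ground set) of a complex: the union of all of its faces. -/
def vertexSet {α : Type*} [DecidableEq α] (Δ : Finset (Finset α)) : Finset α :=
  Δ.sup id

/-- The number of vertices of a complex. -/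
def nverts {α : Type*} [DecidableEq α] (Δ : Finset (Finset α)) : ℕ :=
  (vertexSet Δ).card

/-- The full `(d-1)`-simplex `Δ_{d-1}`: all subsets of a `d`-element vertex set. -/
def simplexC (d : ℕ) : SC := (Finset.range d).powerset

/-- The boundary complex of the simplex on `k` vertices (a `(k-2)`-sphere):
all proper subsets of a `k`-element vertex set. -/
def boundaryC (k : ℕ) : SC := ((Finset.range k).powerset).erase (Finset.range k)

/-- Encoding of finite subsets of `ℕ` as natural numbers (injective). -/
def enc : Finset ℕ → ℕ := Encodable.encode

/-- `C` is a chain of sets under inclusion. -/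
def IsChainF (C : Finset (Finset ℕ)) : Prop := ∀ s ∈ C, ∀ t ∈ C, s ⊆ t ∨ t ⊆ s

/-- The barycentric subdivision `sd(Δ)`: its vertices are (encodings of) the
nonempty faces of `Δ`, and its faces are the chains of nonempty faces of `Δ`. -/
def sd (Δ : SC) : SC :=
  ((Δ.erase ∅).powerset.filter IsChainF).image (fun C => C.image enc)

/-- The induced subcomplex `Δ_W` on a vertex subset `W`. -/
def inducedSC {α : Type*} [DecidableEq α] (Δ : Finset (Finset α)) (W : Finset α) :
    Finset (Finset α) := Δ.filter (fun s => s ⊆ W)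

/-- `fvec Δ k` is the number of faces of `Δ` of cardinality `k`
(i.e. of dimension `k-1`); so `f_{i}^Δ = fvec Δ (i+1)`. -/
def fvec (Δ : SC) (k : ℕ) : ℕ := (Δ.filter (fun s => s.card = k)).card

/-- A minimal non-face of a complex. -/
def IsMinNonFace {α : Type*} [DecidableEq α] (Δ : Finset (Finset α)) (N : Finset α) : Prop :=
  N ⊆ vertexSet Δ ∧ N ∉ Δ ∧ ∀ M ⊂ N, M ∈ Δ

/-- `t_1(K[Δ])`: the largest cardinality of a minimal non-face of `Δ`, equivalently the
largest degree of a minimal generator of the Stanley-Reisner ideal `I_Δ`. -/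
def t1 {α : Type*} [DecidableEq α] (Δ : Finset (Finset α)) : ℕ :=
  ((vertexSet Δ).powerset.filter (fun N => IsMinNonFace Δ N)).sup Finset.card

/-- A complex is flag if all its minimal non-faces have cardinality `2`. -/
def IsFlag {α : Type*} [DecidableEq α] (Δ : Finset (Finset α)) : Prop :=
  ∀ N : Finset α, IsMinNonFace Δ N → N.card = 2

/-- A complex is a full simplex if it consists of all subsets of its vertex set. -/
def IsFullSimplex {α : Type*} [DecidableEq α] (Δ : Finset (Finset α)) : Prop :=
  Δ = (vertexSet Δ).powerset

/-- Abstract isomorphism of simplicial complexes (possibly on different ground sets):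
there is a map of vertices, injective on the vertex set, carrying the faces of the first
complex exactly onto the faces of the second. -/
def ComplexIso {α β : Type*} [DecidableEq α] [DecidableEq β]
    (Δ : Finset (Finset α)) (Γ : Finset (Finset β)) : Prop :=
  ∃ φ : α → β, Set.InjOn φ ↑(vertexSet Δ) ∧ Γ = Δ.image (fun s => s.image φ)

variable (K : Type*) [Field K]

/-- The boundary of (the indicator chain of) a single face, with the usual signs coming
from the ordering of the vertices. -/
def bdryFace (s : Finset ℕ) : Finset ℕ →₀ K :=
  ∑ v ∈ s, ((-1 : K) ^ ((s.filter (fun w => w < v)).card)) • Finsupp.single (s.erase v) (1 : K)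

/-- The simplicial boundary operator on the (augmented/reduced) chain space. -/
def bdry : (Finset ℕ →₀ K) →ₗ[K] (Finset ℕ →₀ K) :=
  Finsupp.lsum K fun s => LinearMap.toSpanSingleton K (Finset ℕ →₀ K) (bdryFace K s)

/-- The span of the faces of `Δ` of cardinality `n` (empty for `n < 0`):
the space of `(n-1)`-dimensional reduced chains of `Δ`. -/
def facesSpan (Δ : SC) (n : ℤ) : Submodule K (Finset ℕ →₀ K) :=
  Submodule.span K ((fun s => Finsupp.single s (1 : K)) '' {s | s ∈ Δ ∧ (s.card : ℤ) = n})

/-- Reduced `(n-1)`-cycles of `Δ`. -/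
def cyclesOn (Δ : SC) (n : ℤ) : Submodule K (Finset ℕ →₀ K) :=
  facesSpan K Δ n ⊓ LinearMap.ker (bdry K)

/-- Reduced `(n-1)`-boundaries of `Δ`. -/
def boundariesOn (Δ : SC) (n : ℤ) : Submodule K (Finset ℕ →₀ K) :=
  Submodule.map (bdry K) (facesSpan K Δ (n + 1))

/-- `redHdim K Δ n = dim_K H̃_{n-1}(Δ; K)`, the dimension of reduced simplicial homology
of `Δ` in the degree whose chains are the faces of cardinality `n`. -/
def redHdim (Δ : SC) (n : ℤ) : ℕ :=
  Module.finrank K ↥(cyclesOn K Δ n) -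
    Module.finrank K ↥(boundariesOn K Δ n ⊓ cyclesOn K Δ n)

/-- The graded Betti number `β_{i,j}(K[Δ]) = dim_K Tor_i^S(K[Δ], K)_j` of the
Stanley-Reisner ring of `Δ`, expressed (via Hochster's formula) through reduced homology of
induced subcomplexes: `β_{i,j} = Σ_{W ⊆ Ω, #W = j} dim_K H̃_{j-i-1}(Δ_W; K)`. -/
def bettiSR (Δ : SC) (i j : ℕ) : ℕ :=
  ∑ W ∈ (vertexSet Δ).powerset.filter (fun W => W.card = j),
    redHdim K (inducedSC Δ W) ((j : ℤ) - i)

/-- The projective dimension of `K[Δ]` over the polynomial ring: the largest homological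
degree with a nonzero Betti number. -/
def pdimSR (Δ : SC) : ℕ :=
  ((Finset.range (nverts Δ + 1)).filter
    (fun i => ∃ j ∈ Finset.range (2 * nverts Δ + 1), bettiSR K Δ i j ≠ 0)).sup id

/-- The depth of `K[Δ]` (via the Auslander–Buchsbaum formula). -/
def depthSR (Δ : SC) : ℕ := nverts Δ - pdimSR K Δ

/-- The Castelnuovo–Mumford regularity of `K[Δ]`:
the largest `j - i` with `β_{i,j}(K[Δ]) ≠ 0`. -/
def regSR (Δ : SC) : ℕ :=
  ((Finset.range (nverts Δ + 1) ×ˢ Finset.range (2 * nverts Δ + 1))).sup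
    (fun p => if bettiSR K Δ p.1 p.2 ≠ 0 then p.2 - p.1 else 0)

/-- The number of homological degrees `i` with `β_{i,i+j}(K[Δ]) ≠ 0`. -/
def strandCount (Δ : SC) (j : ℕ) : ℕ :=
  ((Finset.range (nverts Δ + 1)).filter (fun i => bettiSR K Δ i (i + j) ≠ 0)).card

/-- The numbers `m_j(d)`: `m_j(d) = j` if `j ≤ d/2`, and
`m_j(d) = 2^{a+2}(c+d-j) - 2d + j` if `j ≥ d/2`, where `2j-d = a(d-j)+c`, `0 ≤ c < d-j`. -/
def mj (d j : ℕ) : ℕ :=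
  if 2 * j ≤ d then j
  else 2 ^ ((2 * j - d) / (d - j) + 2) * ((2 * j - d) % (d - j) + (d - j)) + j - 2 * d

/-- `N(d)`: the number of vertices of `sd^3(Δ_{d-1})` not lying on the boundary
of `sd^3(Δ_{d-1})`. -/
def Nd (d : ℕ) : ℕ :=
  ((vertexSet (sd^[3] (simplexC d))) \ (vertexSet (sd^[3] (boundaryC d)))).card

/-- The induced subcomplex `σ̃` of `Δ` spanned by the support of a chain `σ`:
all faces of `Δ` contained in some face of the support of `σ`. -/
def cycleCplx (Δ : SC) (σ : Finset ℕ →₀ K) : SC :=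
  Δ.filter (fun F => ∃ G ∈ σ.support, F ⊆ G)

/-- `σ` is a minimal homology `(d-1)`-cycle of the `(d-1)`-dimensional complex `Δ`:
a nonzero `(d-1)`-cycle such that no nonzero `(d-1)`-cycle `σ'` satisfies
`f_i^{σ̃} > f_i^{σ̃'}` and `f_j^{σ̃} = f_j^{σ̃'}` for all `i < j ≤ d-1`, for some `i`. -/
def IsMinimalCycle (Δ : SC) (d : ℕ) (σ : Finset ℕ →₀ K) : Prop :=
  σ ≠ 0 ∧ σ ∈ cyclesOn K Δ (d : ℤ) ∧
    ∀ σ' : Finset ℕ →₀ K, σ' ≠ 0 → σ' ∈ cyclesOn K Δ (d : ℤ) →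
      ¬ ∃ i ≤ d - 1, fvec (cycleCplx K Δ σ') (i + 1) < fvec (cycleCplx K Δ σ) (i + 1) ∧
          ∀ j, i < j → j ≤ d - 1 →
            fvec (cycleCplx K Δ σ) (j + 1) = fvec (cycleCplx K Δ σ') (j + 1)

/-- The support of a lattice point, as a set of natural numbers. -/
def tupSupp {n : ℕ} (a : Fin n → ℕ) : Finset ℕ :=
  (Finset.univ.filter (fun l : Fin n => a l ≠ 0)).image Fin.val

/-- The `k`-th component of `𝔦(a) = Σ_l a_l u_l`, where `u_l = e_l + ⋯ + e_n`;
so `𝔦(a)_k = Σ_{l ≤ k} a_l`. -/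
def iComp {n : ℕ} (a : Fin n → ℤ) (k : Fin n) : ℤ :=
  ∑ l ∈ Finset.univ.filter (fun l : Fin n => l ≤ k), a l

/-- The compatibility condition on pairs of vertices in the edgewise subdivision:
`𝔦(a-b) ∈ {0,1}^n` or `𝔦(b-a) ∈ {0,1}^n`. -/
def edgeOK {n : ℕ} (a b : Fin n → ℕ) : Prop :=
  (∀ k, iComp (fun l => (a l : ℤ) - (b l : ℤ)) k ∈ ({0, 1} : Set ℤ)) ∨
  (∀ k, iComp (fun l => (b l : ℤ) - (a l : ℤ)) k ∈ ({0, 1} : Set ℤ))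

/-- The `r`-th edgewise subdivision of a complex `Δ` on vertex set `[n]`, as a complex on
the ground set `Ω_{r,n}` of lattice points (tuples). -/
def edgewiseT (n r : ℕ) (Δ : SC) : Finset (Finset (Fin n → ℕ)) :=
  (Finset.Nat.antidiagonalTuple n r).powerset.filter
    (fun F => F.sup tupSupp ∈ Δ ∧ ∀ a ∈ F, ∀ b ∈ F, edgeOK a b)

/-- Encoding of lattice points as natural numbers (injective). -/
def encTup {n : ℕ} (a : Fin n → ℕ) : ℕ := Encodable.encode (List.ofFn a)

/-- The `r`-th edgewise subdivision `Δ^{⟨r⟩}`, re-encoded as a complex on `ℕ`. -/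
def edgewise (n r : ℕ) (Δ : SC) : SC :=
  (edgewiseT n r Δ).image (fun F => F.image encTup)

end

section helpers
open scoped Classical

variable {K : Type*} [Field K]

/-- sign -/
noncomputable def eps (K : Type*) [Field K] (v : ℕ) (s : Finset ℕ) : K :=
  (-1 : K) ^ ((s.filter (fun w => w < v)).card)

lemma eps_sq (v : ℕ) (s : Finset ℕ) : eps K v s * eps K v s = 1 := by
  unfold eps; rw [← pow_add, ← two_mul, pow_mul]; simp

lemma eps_ne (v : ℕ) (s : Finset ℕ) : eps K v s ≠ 0 := by
  intro h; have := eps_sq (K := K) v s; simp [h] at this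

lemma eps_erase_self (v : ℕ) (s : Finset ℕ) : eps K v (s.erase v) = eps K v s := by
  unfold eps; congr 2; ext w; simp; omega

lemma eps_insert_self (v : ℕ) (s : Finset ℕ) : eps K v (insert v s) = eps K v s := by
  unfold eps; congr 2; ext w; simp; omega

lemma eps_insert_lt (v u : ℕ) (s : Finset ℕ) (hv : v ∉ s) (h : v < u) :
    eps K u (insert v s) = - eps K u s := by
  unfold eps
  rw [Finset.filter_insert, if_pos h, Finset.card_insert_of_notMem (by simp [hv]), pow_succ]; ring

lemma eps_insert_ge (v u : ℕ) (s : Finset ℕ) (h : ¬ v < u) :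
    eps K u (insert v s) = eps K u s := by
  unfold eps
  rw [Finset.filter_insert, if_neg h]

lemma eps_comm (u v : ℕ) (s : Finset ℕ) (hu : u ∈ s) (hv : v ∉ s) :
    eps K v s * eps K u (insert v s) = - (eps K u s * eps K v (s.erase u)) := by
  have hne : u ≠ v := fun h => hv (h ▸ hu)
  have hs : s = insert u (s.erase u) := (Finset.insert_erase hu).symm
  have h1 : u ∉ s.erase u := by simp
  rcases lt_or_gt_of_ne hne with h | h
  · rw [eps_insert_ge v u s (by omega)]
    conv_lhs => rw [hs, eps_insert_lt u v _ h1 h, ← hs]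
    ring
  · rw [eps_insert_lt v u s hv h]
    conv_lhs => lhs; rw [hs, eps_insert_ge u v _ (by omega)]
    ring

noncomputable def coneFace (K : Type*) [Field K] (v : ℕ) (s : Finset ℕ) : Finset ℕ →₀ K :=
  if v ∈ s then 0 else Finsupp.single (insert v s) (eps K v s)

noncomputable def cone (K : Type*) [Field K] (v : ℕ) : (Finset ℕ →₀ K) →ₗ[K] (Finset ℕ →₀ K) :=
  Finsupp.lsum K fun s => LinearMap.toSpanSingleton K (Finset ℕ →₀ K) (coneFace K v s)

lemma cone_single (v : ℕ) (s : Finset ℕ) (a : K) :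
    cone K v (Finsupp.single s a) = a • coneFace K v s := by
  simp [cone]

lemma bdry_single (s : Finset ℕ) (a : K) :
    bdry K (Finsupp.single s a) = a • bdryFace K s := by
  simp [bdry]

lemma bdryFace_eq (s : Finset ℕ) :
    bdryFace K s = ∑ v ∈ s, Finsupp.single (s.erase v) (eps K v s) := by
  unfold bdryFace eps
  refine Finset.sum_congr rfl fun v _ => ?_
  rw [Finsupp.smul_single, smul_eq_mul, mul_one]

lemma homotopy (v : ℕ) (x : Finset ℕ →₀ K) :
    bdry K (cone K v x) + cone K v (bdry K x) = x := by
  induction x using Finsupp.induction_linear with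
  | zero => simp
  | add f g hf hg =>
    rw [map_add, map_add, map_add, map_add]
    conv_rhs => rw [← hf, ← hg]
    abel
  | single s a =>
    rw [cone_single, bdry_single, map_smul, map_smul, ← smul_add]
    have : bdry K (coneFace K v s) + cone K v (bdryFace K s) = Finsupp.single s 1 := by
      rw [bdryFace_eq, map_sum]
      simp only [cone_single]
      by_cases hv : v ∈ s
      · rw [coneFace, if_pos hv, map_zero, zero_add]
        rw [Finset.sum_eq_single_of_mem v hv]
        · rw [coneFace, if_neg (by simp), Finset.insert_erase hv, eps_erase_self,
            Finsupp.smul_single, smul_eq_mul, eps_sq]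
        · intro u hu hne
          rw [coneFace, if_pos (by simp [hv, hne.symm]), smul_zero]
      · rw [coneFace, if_neg hv, bdry_single, bdryFace_eq, Finset.sum_insert hv,
          Finset.erase_insert hv, smul_add, Finsupp.smul_single, smul_eq_mul, eps_insert_self,
          eps_sq, add_assoc]
        convert add_zero _
        rw [Finset.smul_sum, ← Finset.sum_add_distrib]
        refine Finset.sum_eq_zero fun u hu => ?_
        have hne : v ≠ u := fun h => hv (h ▸ hu)
        rw [coneFace, if_neg (by simp [hv]), Finsupp.smul_single, Finsupp.smul_single,
          smul_eq_mul, smul_eq_mul, eps_comm u v s hu hv, Finset.erase_insert_of_ne hne,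
          ← Finsupp.single_add]
        simp
    rw [this]; simp

lemma bdry_bdry (x : Finset ℕ →₀ K) : bdry K (bdry K x) = 0 := by
  suffices h : ∀ s : Finset ℕ, bdry K (bdry K (Finsupp.single s (1:K))) = 0 by
    induction x using Finsupp.induction_linear with
    | zero => simp
    | add f g hf hg => simp [hf, hg]
    | single s a =>
      have := h s
      rw [← mul_one a, ← smul_eq_mul, ← Finsupp.smul_single, map_smul, map_smul, this, smul_zero]
  intro s
  induction s using Finset.induction_on with
  | empty => rw [bdry_single, bdryFace]; simp
  | insert v s hv ih =>
    have h1 : Finsupp.single (insert v s) (1:K) = eps K v s • cone K v (Finsupp.single s 1) := by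
      rw [cone_single, coneFace, if_neg hv]
      simp [eps_sq]
    have h2 : ∀ y : Finset ℕ →₀ K, bdry K (cone K v y) = y - cone K v (bdry K y) :=
      fun y => eq_sub_of_add_eq (homotopy v y)
    rw [h1, map_smul, map_smul, h2, map_sub, h2, ih]
    simp

lemma cone_apply_insert (v : ℕ) (x : Finset ℕ →₀ K) (G : Finset ℕ) (hG : v ∉ G) :
    cone K v x (insert v G) = eps K v G * x G := by
  induction x using Finsupp.induction_linear with
  | zero => simp
  | add f g hf hg => rw [map_add, Finsupp.add_apply, hf, hg, Finsupp.add_apply, mul_add]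
  | single s a =>
    rw [cone_single, coneFace]
    by_cases hs : v ∈ s
    · have : s ≠ G := fun h => hG (h ▸ hs)
      rw [if_pos hs, Finsupp.single_eq_of_ne this.symm]; simp
    · rw [if_neg hs]
      by_cases h : s = G
      · subst h; simp [mul_comm]
      · have h' : insert v s ≠ insert v G := by
          intro h'; apply h
          rw [← Finset.erase_insert hs, h', Finset.erase_insert hG]
        rw [Finsupp.single_eq_of_ne (Ne.symm h)]
        simp [Finsupp.single_eq_of_ne h'.symm]

lemma cone_apply_not (v : ℕ) (x : Finset ℕ →₀ K) (G : Finset ℕ) (hG : v ∉ G) :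
    cone K v x G = 0 := by
  induction x using Finsupp.induction_linear with
  | zero => simp
  | add f g hf hg => rw [map_add, Finsupp.add_apply, hf, hg, add_zero]
  | single s a =>
    rw [cone_single, coneFace]
    by_cases hs : v ∈ s
    · simp [hs]
    · have : insert v s ≠ G := fun h => hG (h ▸ Finset.mem_insert_self _ _)
      rw [if_neg hs]
      simp [Finsupp.single_eq_of_ne this.symm]

lemma cone_support {v : ℕ} {x : Finset ℕ →₀ K} {G : Finset ℕ} (h : cone K v x G ≠ 0) :
    v ∈ G ∧ x (G.erase v) ≠ 0 := by
  by_cases hG : v ∈ G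
  · refine ⟨hG, fun h0 => h ?_⟩
    rw [← Finset.insert_erase hG, cone_apply_insert _ _ _ (by simp), h0, mul_zero]
  · exact absurd (cone_apply_not v x G hG) h

/-- boundary support -/
lemma bdry_apply_ne {x : Finset ℕ →₀ K} {G : Finset ℕ} (h : bdry K x G ≠ 0) :
    ∃ v, v ∉ G ∧ x (insert v G) ≠ 0 := by
  by_contra hc
  push Not at hc
  apply h
  have : x = ∑ s ∈ x.support, Finsupp.single s (x s) := by
    conv_lhs => rw [← Finsupp.sum_single x]
    rfl
  rw [this, map_sum, Finsupp.finsetSum_apply]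
  refine Finset.sum_eq_zero fun s hs => ?_
  rw [bdry_single, bdryFace_eq, Finsupp.smul_apply, Finsupp.finsetSum_apply,
    Finset.sum_eq_zero, smul_zero]
  intro v hv
  rw [Finsupp.single_eq_of_ne]
  rintro rfl
  have := hc v (by simp)
  rw [Finset.insert_erase hv] at this
  simp [this] at hs

end helpers

section helpers2
open scoped Classical

variable {K : Type*} [Field K]

lemma mem_facesSpan {Δ : SC} {n : ℤ} {x : Finset ℕ →₀ K} :
    x ∈ facesSpan K Δ n ↔ ∀ G, x G ≠ 0 → G ∈ Δ ∧ (G.card : ℤ) = n := by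
  unfold facesSpan
  rw [← Finsupp.supported_eq_span_single, Finsupp.mem_supported]
  constructor
  · intro h G hG
    exact h (by simpa using hG)
  · intro h G hG
    exact h G (by simpa using hG)

def HN (K : Type*) [Field K] (Δ : SC) (n : ℤ) : Prop :=
  ∃ z ∈ cyclesOn K Δ n, z ∉ boundariesOn K Δ n

lemma HN.redHdim_ne {Δ : SC} {n : ℤ} (h : HN K Δ n) : redHdim K Δ n ≠ 0 := by
  obtain ⟨z, hz, hz'⟩ := h
  have hfin : FiniteDimensional K (facesSpan K Δ n) := by
    unfold facesSpan
    apply FiniteDimensional.span_of_finite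
    apply Set.Finite.image
    exact (Finset.finite_toSet Δ).subset fun s hs => hs.1
  have hfin2 : FiniteDimensional K (cyclesOn K Δ n) :=
    Submodule.finiteDimensional_of_le (inf_le_left : cyclesOn K Δ n ≤ facesSpan K Δ n)
  have hlt : boundariesOn K Δ n ⊓ cyclesOn K Δ n < cyclesOn K Δ n := by
    refine lt_of_le_of_ne inf_le_right fun he => hz' ?_
    rw [← he] at hz
    exact hz.1
  have := Submodule.finrank_lt_finrank_of_lt hlt
  unfold redHdim
  omega

lemma HN_of_facet {Δ : SC} {j : ℕ} (z : Finset ℕ →₀ K) (hz : bdry K z = 0)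
    (hs : ∀ G, z G ≠ 0 → G ∈ Δ ∧ G.card = j) (G : Finset ℕ) (hG : z G ≠ 0)
    (hmax : ∀ v, v ∉ G → insert v G ∉ Δ) : HN K Δ j := by
  refine ⟨z, ⟨mem_facesSpan.2 fun G hG => ?_, hz⟩, ?_⟩
  · exact ⟨(hs G hG).1, by exact_mod_cast (hs G hG).2⟩
  · rintro ⟨y, hy, rfl⟩
    obtain ⟨v, hv, hv'⟩ := bdry_apply_ne hG
    exact hmax v hv (mem_facesSpan.1 hy _ hv').1

lemma bettiSR_ne {Δ : SC} {i j : ℕ} {W : Finset ℕ} (hW : W ⊆ vertexSet Δ) (hc : W.card = i + j)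
    (h : HN K (inducedSC Δ W) j) : bettiSR K Δ i (i + j) ≠ 0 := by
  unfold bettiSR
  intro h0
  rw [Finset.sum_eq_zero_iff] at h0
  have := h0 W (by simp [hW, hc])
  apply h.redHdim_ne
  rw [← this]
  congr 1
  push_cast; ring

/-! ### depth -/

noncomputable def ctr (K : Type*) [Field K] (v : ℕ) : (Finset ℕ →₀ K) →ₗ[K] (Finset ℕ →₀ K) :=
  Finsupp.lsum K fun s => LinearMap.toSpanSingleton K (Finset ℕ →₀ K)
    (if v ∈ s then Finsupp.single (s.erase v) (eps K v s) else 0)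

lemma ctr_apply (v : ℕ) (x : Finset ℕ →₀ K) (G : Finset ℕ) :
    ctr K v x G = if v ∈ G then 0 else eps K v G * x (insert v G) := by
  induction x using Finsupp.induction_linear with
  | zero => simp
  | add f g hf hg => rw [map_add, Finsupp.add_apply, hf, hg]; split_ifs <;> simp [mul_add]
  | single s a =>
    have : ctr K v (Finsupp.single s a) =
        a • (if v ∈ s then Finsupp.single (s.erase v) (eps K v s) else 0) := by simp [ctr]
    rw [this]
    by_cases hs : v ∈ s
    · rw [if_pos hs]
      by_cases hG : v ∈ G
      · have : s.erase v ≠ G := by rintro rfl; simp at hG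
        rw [if_pos hG]; simp [Finsupp.single_eq_of_ne this.symm]
      · rw [if_neg hG]
        by_cases he : s = insert v G
        · subst he
          rw [Finset.erase_insert hG, eps_insert_self]; simp [mul_comm]
        · have : s.erase v ≠ G := by rintro rfl; exact he (Finset.insert_erase hs).symm
          simp [Finsupp.single_eq_of_ne this.symm, Finsupp.single_eq_of_ne (Ne.symm he)]
    · rw [if_neg hs]
      have : s ≠ insert v G := by rintro rfl; simp at hs
      simp [Finsupp.single_eq_of_ne this.symm]

def lkF (Δ : SC) (F : Finset ℕ) : SC := Δ.filter (fun s => Disjoint s F ∧ s ∪ F ∈ Δ)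
def delF (Δ : SC) (T : Finset ℕ) : SC := Δ.filter (fun s => Disjoint s T)

lemma HN_step (Δ : SC) (hC : IsComplex Δ) (v : ℕ) (n : ℤ) (h : HN K (lkF Δ {v}) n) :
    HN K (delF Δ {v}) n ∨ HN K Δ (n + 1) := by
  obtain ⟨z, ⟨hz1, hz2⟩, hz3⟩ := h
  have hz2 : bdry K z = 0 := hz2
  replace hz1 := mem_facesSpan.1 hz1
  by_contra hcon
  push Not at hcon
  obtain ⟨hc1, hc2⟩ := hcon
  have hb : z ∈ boundariesOn K (delF Δ {v}) n := by
    by_contra hb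
    refine hc1 ⟨z, ⟨mem_facesSpan.2 fun G hG => ?_, hz2⟩, hb⟩
    obtain ⟨h1, h2⟩ := hz1 G hG
    refine ⟨?_, h2⟩
    simp only [lkF, mem_filter] at h1
    simp only [delF, mem_filter]
    exact ⟨h1.1, h1.2.1⟩
  obtain ⟨c, hc, hcz⟩ := hb
  have hc := mem_facesSpan.1 hc
  have hcv : ∀ G, v ∈ G → c G = 0 := by
    intro G hv
    by_contra h0
    have := (hc G h0).1
    simp only [delF, mem_filter] at this
    simp [hv] at this
  have hzv : ∀ G, v ∈ G → z G = 0 := by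
    intro G hv
    by_contra h0
    have := (hz1 G h0).1
    simp only [lkF, mem_filter] at this
    simp [hv] at this
  have h2 : ∀ y : Finset ℕ →₀ K, bdry K (cone K v y) = y - cone K v (bdry K y) :=
    fun y => eq_sub_of_add_eq (homotopy v y)
  have hy : cone K v z - c ∈ cyclesOn K Δ (n + 1) := by
    refine ⟨Submodule.sub_mem _ (mem_facesSpan.2 fun G hG => ?_) (mem_facesSpan.2 fun G hG => ?_), ?_⟩
    · obtain ⟨h3, h4⟩ := cone_support hG
      obtain ⟨h5, h6⟩ := hz1 _ h4
      simp only [lkF, mem_filter] at h5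
      constructor
      · have : G.erase v ∪ {v} = G := by
          rw [Finset.union_comm, ← Finset.insert_eq, Finset.insert_erase h3]
        rw [← this]; exact h5.2.2
      · rw [← h6, Finset.card_erase_of_mem h3]
        have := Finset.card_pos.2 ⟨v, h3⟩
        omega
    · obtain ⟨h5, h6⟩ := hc _ hG
      simp only [delF, mem_filter] at h5
      exact ⟨h5.1, h6⟩
    · show bdry K _ = 0
      rw [map_sub, h2, hz2, hcz]; simp
  have hb : cone K v z - c ∈ boundariesOn K Δ (n + 1) := by
    by_contra hb
    exact hc2 ⟨_, hy, hb⟩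
  obtain ⟨b, hb, hbz⟩ := hb
  have hb := mem_facesSpan.1 hb
  set b1 := ctr K v b with hb1
  set b2 := b - cone K v b1 with hb2
  have hb1v : ∀ G, v ∈ G → b1 G = 0 := by
    intro G hG; rw [hb1, ctr_apply, if_pos hG]
  have hb2v : ∀ G, v ∈ G → b2 G = 0 := by
    intro G hG
    rw [hb2, Finsupp.sub_apply, ← Finset.insert_erase hG, cone_apply_insert _ _ _ (by simp), hb1,
      ctr_apply, if_neg (by simp), ← mul_assoc, eps_sq, one_mul, sub_self]
  have hav : ∀ x : Finset ℕ →₀ K, (∀ G, v ∈ G → x G = 0) → ∀ G, v ∈ G → bdry K x G = 0 := by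
    intro x hx G hG
    by_contra h0
    obtain ⟨u, hu, hu'⟩ := bdry_apply_ne h0
    exact hu' (hx _ (by simp [hG]))
  apply hz3
  refine ⟨-b1, ?_, ?_⟩
  · refine Submodule.neg_mem _ (mem_facesSpan.2 fun G hG => ?_)
    rw [hb1, ctr_apply] at hG
    split_ifs at hG with hv
    · simp at hG
    obtain ⟨h5, h6⟩ := hb (insert v G) (right_ne_zero_of_mul hG)
    rw [Finset.card_insert_of_notMem hv] at h6
    refine ⟨?_, by push_cast at h6; linarith⟩
    simp only [lkF, mem_filter]
    refine ⟨hC _ h5 _ (Finset.subset_insert _ _), by simpa using hv, ?_⟩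
    rw [Finset.union_comm, ← Finset.insert_eq]; exact h5
  · rw [map_neg]
    ext G
    rw [Finsupp.neg_apply]
    by_cases hG : v ∈ G
    · rw [hzv G hG, hav b1 hb1v G hG, neg_zero]
    · have h7 : b = cone K v b1 + b2 := by rw [hb2]; abel
      have h8 := DFunLike.congr_fun hbz (insert v G)
      rw [h7, map_add, h2, Finsupp.add_apply, Finsupp.sub_apply, Finsupp.sub_apply,
        cone_apply_insert _ _ _ hG, cone_apply_insert _ _ _ hG, hcv _ (by simp),
        hav b2 hb2v _ (by simp), hb1v _ (by simp)] at h8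
      have : eps K v G * (- bdry K b1 G) = eps K v G * z G := by linear_combination h8
      exact mul_left_cancel₀ (eps_ne v G) this

lemma HN_link (F : Finset ℕ) : ∀ (Δ : SC) (_ : IsComplex Δ) (n : ℤ), HN K (lkF Δ F) n →
    ∃ T ⊆ F, HN K (delF Δ (F \ T)) (n + T.card) := by
  induction F using Finset.induction_on with
  | empty =>
    intro Δ hC n h
    refine ⟨∅, subset_rfl, ?_⟩
    have h1 : lkF Δ ∅ = Δ := by ext s; simp [lkF]
    have h2 : delF Δ (∅ \ ∅) = Δ := by ext s; simp [delF]
    rw [h2]; rw [h1] at h; simpa using h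
  | insert v F hv ih =>
    intro Δ hC n h
    have hC1 : IsComplex (lkF Δ F) := by
      intro s hs t ht
      simp only [lkF, mem_filter] at hs ⊢
      exact ⟨hC _ hs.1 _ ht, hs.2.1.mono_left ht, hC _ hs.2.2 _ (Finset.union_subset_union_left ht)⟩
    have hC2 : IsComplex (delF Δ {v}) := by
      intro s hs t ht
      simp only [delF, mem_filter] at hs ⊢
      exact ⟨hC _ hs.1 _ ht, hs.2.mono_left ht⟩
    have e1 : lkF Δ (insert v F) = lkF (lkF Δ F) {v} := by
      ext s
      simp only [lkF, mem_filter]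
      have e : s ∪ insert v F = s ∪ {v} ∪ F := by
        rw [Finset.insert_eq, Finset.union_assoc]
      rw [e]
      constructor
      · rintro ⟨h1, h2, h3⟩
        rw [Finset.disjoint_insert_right] at h2
        refine ⟨⟨h1, h2.2, hC _ h3 _ ?_⟩, by simpa using h2.1, hC _ h3 _ Finset.subset_union_left, ?_, h3⟩
        · exact Finset.union_subset_union_left Finset.subset_union_left
        · rw [Finset.disjoint_union_left]; exact ⟨h2.2, by simpa using hv⟩
      · rintro ⟨⟨h1, h2, h3⟩, h4, h5, h6, h7⟩
        refine ⟨h1, ?_, h7⟩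
        rw [Finset.disjoint_insert_right]
        exact ⟨by simpa using h4, h2⟩
    have e2 : delF (lkF Δ F) {v} = lkF (delF Δ {v}) F := by
      ext s
      simp only [lkF, delF, mem_filter]
      constructor
      · rintro ⟨⟨h1, h2, h3⟩, h4⟩
        refine ⟨⟨h1, h4⟩, h2, h3, ?_⟩
        rw [Finset.disjoint_union_left]; exact ⟨h4, by simpa using hv⟩
      · rintro ⟨⟨h1, h4⟩, h2, h3, h5⟩
        exact ⟨⟨h1, h2, h3⟩, h4⟩
    rw [e1] at h
    rcases HN_step _ hC1 _ _ h with h | h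
    · rw [e2] at h
      obtain ⟨T, hT, hT'⟩ := ih _ hC2 n h
      refine ⟨T, hT.trans (Finset.subset_insert _ _), ?_⟩
      have e3 : delF (delF Δ {v}) (F \ T) = delF Δ (insert v F \ T) := by
        ext s
        have hvT : v ∉ T := fun h => hv (hT h)
        simp only [delF, mem_filter]
        rw [Finset.insert_sdiff_of_notMem _ hvT, Finset.disjoint_insert_right]
        simp only [Finset.disjoint_singleton_right]
        tauto
      rwa [← e3]
    · obtain ⟨T, hT, hT'⟩ := ih _ hC (n + 1) h
      refine ⟨insert v T, Finset.insert_subset_insert _ hT, ?_⟩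
      have hvT : v ∉ T := fun h => hv (hT h)
      have e3 : insert v F \ insert v T = F \ T := by
        ext x; simp only [mem_sdiff, mem_insert]
        constructor
        · rintro ⟨h1, h2⟩; tauto
        · rintro ⟨h1, h2⟩
          have : x ≠ v := by rintro rfl; exact hv h1
          tauto
      rw [e3, Finset.card_insert_of_notMem hvT]
      convert hT' using 1
      push_cast; ring

lemma mem_vertexSet {Δ : SC} {v : ℕ} : v ∈ vertexSet Δ ↔ ∃ s ∈ Δ, v ∈ s := by
  simp [vertexSet, Finset.mem_sup]

lemma face_subset_vertexSet {Δ : SC} {s : Finset ℕ} (h : s ∈ Δ) : s ⊆ vertexSet Δ :=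
  fun _ hv => mem_vertexSet.2 ⟨s, h, hv⟩

lemma depth_le (Δ : SC) (hC : IsComplex Δ) (d : ℕ) (hdim : Δ.sup Finset.card = d)
    (F : Finset ℕ) (hF : F ∈ Δ) (hFc : F.card = d) : depthSR K Δ ≤ d := by
  have hlk : HN K (lkF Δ F) 0 := by
    have : lkF Δ F = {∅} := by
      ext s
      simp only [lkF, mem_filter, mem_singleton]
      constructor
      · rintro ⟨h1, h2, h3⟩
        have h4 : (s ∪ F).card ≤ d := by rw [← hdim]; exact Finset.le_sup (f := Finset.card) h3
        rw [Finset.card_union_of_disjoint h2] at h4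
        rw [← Finset.card_eq_zero]; omega
      · rintro rfl
        simp [hF, hC F hF ∅ (by simp)]
    rw [this]
    refine HN_of_facet (j := 0) (Finsupp.single ∅ 1) ?_ ?_ ∅ (by simp) ?_
    · rw [bdry_single, bdryFace_eq]; simp
    · intro G hG
      by_cases h : G = ∅
      · simp [h]
      · simp [Finsupp.single_eq_of_ne h] at hG
    · intro v _; simp
  obtain ⟨T, hT, h⟩ := HN_link F Δ hC 0 hlk
  rw [zero_add] at h
  have hFV := face_subset_vertexSet hF
  have hn : d ≤ nverts Δ := by rw [← hFc]; exact Finset.card_le_card hFV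
  have hd : delF Δ (F \ T) = inducedSC Δ (vertexSet Δ \ (F \ T)) := by
    ext s
    simp only [delF, inducedSC, mem_filter]
    refine and_congr_right fun hs => ?_
    rw [Finset.subset_sdiff]
    exact ⟨fun h => ⟨face_subset_vertexSet hs, h⟩, fun h => h.2⟩
  rw [hd] at h
  have hTc := Finset.card_le_card hT
  have hb : bettiSR K Δ (nverts Δ - d) (nverts Δ - d + T.card) ≠ 0 := by
    refine bettiSR_ne (Finset.sdiff_subset) ?_ h
    rw [Finset.card_sdiff_of_subset (Finset.sdiff_subset.trans hFV), Finset.card_sdiff_of_subset hT]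
    show nverts Δ - _ = _
    omega
  have : nverts Δ - d ≤ pdimSR K Δ := by
    unfold pdimSR
    refine Finset.le_sup (f := id) (b := nverts Δ - d) ?_
    simp only [mem_filter, mem_range]
    exact ⟨by omega, _, by omega, hb⟩
  unfold depthSR
  omega

lemma pdim_le (Δ : SC) : pdimSR K Δ ≤ nverts Δ := by
  unfold pdimSR
  refine Finset.sup_le fun i hi => ?_
  simp only [mem_filter, mem_range] at hi
  simp only [id]; omega

end helpers2

section helpers3
open scoped Classical

variable {K : Type*} [Field K]

noncomputable def Tf (b : Finset ℕ → ℕ) (c : Finset ℕ →₀ K) (s : Finset ℕ) : Finset ℕ →₀ K :=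
  if s = ∅ then c else
    cone K (b s) (∑ v ∈ s.attach, eps K v.1 s • Tf b c (s.erase v.1))
termination_by s.card
decreasing_by exact Finset.card_erase_lt_of_mem v.2

noncomputable def TT (b : Finset ℕ → ℕ) (c : Finset ℕ →₀ K) :
    (Finset ℕ →₀ K) →ₗ[K] (Finset ℕ →₀ K) :=
  Finsupp.lsum K fun s => LinearMap.toSpanSingleton K (Finset ℕ →₀ K) (Tf b c s)

lemma TT_single (b : Finset ℕ → ℕ) (c : Finset ℕ →₀ K) (s : Finset ℕ) (a : K) :
    TT b c (Finsupp.single s a) = a • Tf b c s := by simp [TT]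

lemma Tf_empty (b : Finset ℕ → ℕ) (c : Finset ℕ →₀ K) : Tf b c ∅ = c := by
  rw [Tf, if_pos rfl]

lemma TT_bdryFace (b : Finset ℕ → ℕ) (c : Finset ℕ →₀ K) (s : Finset ℕ) :
    TT b c (bdryFace K s) = ∑ v ∈ s, eps K v s • Tf b c (s.erase v) := by
  rw [bdryFace_eq, map_sum]; simp only [TT_single]

lemma Tf_ne (b : Finset ℕ → ℕ) (c : Finset ℕ →₀ K) (s : Finset ℕ) (hs : s ≠ ∅) :
    Tf b c s = cone K (b s) (TT b c (bdryFace K s)) := by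
  rw [TT_bdryFace, Tf, if_neg hs]
  congr 1
  exact Finset.sum_attach s (fun v => eps K v s • Tf b c (s.erase v))

lemma bdry_TT (b : Finset ℕ → ℕ) (c : Finset ℕ →₀ K) (hc : bdry K c = 0) (x : Finset ℕ →₀ K) :
    bdry K (TT b c x) = TT b c (bdry K x) := by
  have key : ∀ n, ∀ s : Finset ℕ, s.card ≤ n → bdry K (Tf b c s) = TT b c (bdryFace K s) := by
    intro n
    induction n with
    | zero =>
      intro s hs
      have : s = ∅ := by simpa using hs
      subst this
      rw [Tf_empty, hc, TT_bdryFace]; simp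
    | succ n ih =>
      intro s hs
      by_cases h0 : s = ∅
      · subst h0; rw [Tf_empty, hc, TT_bdryFace]; simp
      · have h00 : ∀ y : Finset ℕ →₀ K, bdry K (cone K (b s) y) = y - cone K (b s) (bdry K y) :=
          fun y => eq_sub_of_add_eq (homotopy (b s) y)
        rw [Tf_ne b c s h0, h00]
        have h1 : bdry K (TT b c (bdryFace K s)) = TT b c (bdry K (bdryFace K s)) := by
          rw [TT_bdryFace, map_sum, bdryFace_eq, map_sum, map_sum]
          refine Finset.sum_congr rfl fun v hv => ?_
          rw [map_smul, bdry_single, map_smul, ih]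
          have := Finset.card_erase_lt_of_mem hv
          omega
        have h2 : bdry K (bdryFace K s) = 0 := by
          have := bdry_bdry (Finsupp.single s (1:K))
          rwa [bdry_single, one_smul] at this
        rw [h1, h2]; simp
  induction x using Finsupp.induction_linear with
  | zero => simp
  | add f g hf hg => simp only [map_add, hf, hg]
  | single s a => rw [TT_single, map_smul, key _ s le_rfl, bdry_single, map_smul]

lemma TTb_support_aux {b : Finset ℕ → ℕ} {c : Finset ℕ →₀ K} {s G : Finset ℕ}
    (h : TT b c (bdryFace K s) G ≠ 0) : ∃ v ∈ s, Tf b c (s.erase v) G ≠ 0 := by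
  rw [TT_bdryFace, Finsupp.finsetSum_apply] at h
  obtain ⟨v, hv, h⟩ := Finset.exists_ne_zero_of_sum_ne_zero h
  exact ⟨v, hv, fun h0 => h (by simp [h0])⟩

lemma Tf_support {b : Finset ℕ → ℕ} {c : Finset ℕ →₀ K} : ∀ (n : ℕ) (s G : Finset ℕ), s.card ≤ n →
    Tf b c s G ≠ 0 → ∃ G0 C, c G0 ≠ 0 ∧ IsChainF C ∧ (∀ t ∈ C, t ⊆ s ∧ t ≠ ∅) ∧
      G = G0 ∪ C.image b ∧ G.card = G0.card + s.card := by
  intro n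
  induction n with
  | zero =>
    intro s G hs h
    have : s = ∅ := by simpa using hs
    subst this
    rw [Tf_empty] at h
    exact ⟨G, ∅, h, by simp [IsChainF], by simp, by simp, by simp⟩
  | succ n ih =>
    intro s G hs h
    by_cases h0 : s = ∅
    · subst h0
      rw [Tf_empty] at h
      exact ⟨G, ∅, h, by simp [IsChainF], by simp, by simp, by simp⟩
    rw [Tf_ne b c s h0] at h
    obtain ⟨h1, h2⟩ := cone_support h
    obtain ⟨v, hv, h3⟩ := TTb_support_aux h2
    have hcl := Finset.card_erase_lt_of_mem hv
    obtain ⟨G0, C, hG0, hC, hC1, hC2, hC3⟩ := ih (s.erase v) _ (by omega) h3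
    refine ⟨G0, insert s C, hG0, ?_, ?_, ?_, ?_⟩
    · intro t ht u hu
      rw [Finset.mem_insert] at ht hu
      rcases ht with rfl | ht
      · rcases hu with rfl | hu
        · left; rfl
        · right; exact (hC1 u hu).1.trans (Finset.erase_subset _ _)
      · rcases hu with rfl | hu
        · left; exact (hC1 t ht).1.trans (Finset.erase_subset _ _)
        · exact hC t ht u hu
    · intro t ht
      rw [Finset.mem_insert] at ht
      rcases ht with rfl | ht
      · exact ⟨subset_rfl, h0⟩
      · exact ⟨(hC1 t ht).1.trans (Finset.erase_subset _ _), (hC1 t ht).2⟩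
    · rw [← Finset.insert_erase h1, hC2, Finset.image_insert, Finset.union_insert]
    · rw [Finset.card_erase_of_mem h1, Finset.card_erase_of_mem hv] at hC3
      have := Finset.card_pos.2 ⟨_, h1⟩
      have := Finset.card_pos.2 ⟨_, hv⟩
      omega

lemma TTb_support {b : Finset ℕ → ℕ} {c : Finset ℕ →₀ K} {s G : Finset ℕ}
    (h : TT b c (bdryFace K s) G ≠ 0) : ∃ G0 C, c G0 ≠ 0 ∧ IsChainF C ∧
      (∀ t ∈ C, t ⊂ s ∧ t ≠ ∅) ∧ G = G0 ∪ C.image b ∧ G.card + 1 = G0.card + s.card := by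
  obtain ⟨v, hv, h⟩ := TTb_support_aux h
  obtain ⟨G0, C, hG0, hC, hC1, hC2, hC3⟩ := Tf_support _ (s.erase v) G le_rfl h
  refine ⟨G0, C, hG0, hC, fun t ht => ⟨?_, (hC1 t ht).2⟩, hC2, ?_⟩
  · exact lt_of_le_of_lt (hC1 t ht).1 (Finset.erase_ssubset hv)
  · rw [Finset.card_erase_of_mem hv] at hC3
    have := Finset.card_pos.2 ⟨_, hv⟩
    omega

/-- standard flag -/
def flagH (b : Finset ℕ → ℕ) (a k : ℕ) (G0 : Finset ℕ) : Finset ℕ :=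
  G0 ∪ (Finset.Ico 1 (k + 1)).image (fun m => b (Finset.Ico a (a + m)))

lemma flagH_zero (b : Finset ℕ → ℕ) (a : ℕ) (G0 : Finset ℕ) : flagH b a 0 G0 = G0 := by
  simp [flagH]

lemma flagH_succ (b : Finset ℕ → ℕ) (a k : ℕ) (G0 : Finset ℕ) :
    flagH b a (k + 1) G0 = insert (b (Finset.Ico a (a + (k + 1)))) (flagH b a k G0) := by
  unfold flagH
  have : Finset.Ico 1 (k + 1 + 1) = insert (k + 1) (Finset.Ico 1 (k + 1)) := by
    ext x; simp only [mem_Ico, mem_insert]; omega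
  rw [this, Finset.image_insert, Finset.union_insert]

lemma Ico_ne {a k m : ℕ} (h : m ≠ k) : Finset.Ico a (a + m) ≠ Finset.Ico a (a + k) := by
  intro h'
  have := congrArg Finset.card h'
  simp at this; exact h this

lemma flag_coeff (b : Finset ℕ → ℕ) (c : Finset ℕ →₀ K) (a N : ℕ)
    (hinj : ∀ t ⊆ Finset.Ico a (a + N), ∀ u ⊆ Finset.Ico a (a + N), b t = b u → t = u)
    (hfresh : ∀ t ⊆ Finset.Ico a (a + N), t ≠ ∅ → ∀ G, c G ≠ 0 → b t ∉ G)
    (G0 : Finset ℕ) (hG0 : c G0 ≠ 0) :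
    ∀ k, k + 1 ≤ N → Tf b c (Finset.Ico a (a + k)) (flagH b a k G0) ≠ 0 ∧
      TT b c (bdryFace K (Finset.Ico a (a + (k + 1)))) (flagH b a k G0) ≠ 0 := by
  have aux : ∀ k, k + 1 ≤ N → Tf b c (Finset.Ico a (a + k)) (flagH b a k G0) ≠ 0 →
      TT b c (bdryFace K (Finset.Ico a (a + (k + 1)))) (flagH b a k G0) ≠ 0 := by
    intro k hk h
    rw [TT_bdryFace, Finsupp.finsetSum_apply, Finset.sum_eq_single_of_mem (a + k) (by simp)]
    · have : (Finset.Ico a (a + (k + 1))).erase (a + k) = Finset.Ico a (a + k) := by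
        ext x; simp only [mem_Ico, mem_erase]; omega
      rw [this, Finsupp.smul_apply, smul_eq_mul]
      exact mul_ne_zero (eps_ne _ _) h
    · intro v hv hne
      rw [Finsupp.smul_apply]
      by_contra h0
      have h0 : Tf b c ((Finset.Ico a (a + (k + 1))).erase v) (flagH b a k G0) ≠ 0 :=
        fun h => h0 (by simp [h])
      obtain ⟨G1, C, hG1, hC, hC1, hC2, hC3⟩ := Tf_support _ _ _ le_rfl h0
      simp only [mem_Ico] at hv
      have hsub : Finset.Ico a (a + k) ⊆ Finset.Ico a (a + N) :=
        Finset.Ico_subset_Ico le_rfl (by omega)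
      have hmem : b (Finset.Ico a (a + k)) ∈ flagH b a k G0 := by
        obtain ⟨k', rfl⟩ : ∃ k', k = k' + 1 := ⟨k - 1, by omega⟩
        rw [flagH_succ]; simp
      rw [hC2, Finset.mem_union] at hmem
      rcases hmem with hmem | hmem
      · refine hfresh _ hsub ?_ G1 hG1 hmem
        rw [← Finset.nonempty_iff_ne_empty]
        exact ⟨a, by simp; omega⟩
      · obtain ⟨t, ht, ht'⟩ := Finset.mem_image.1 hmem
        have h5 := (hC1 t ht).1
        have : t = Finset.Ico a (a + k) := by
          refine hinj t ?_ _ hsub ht'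
          refine h5.trans ((Finset.erase_subset _ _).trans ?_)
          exact Finset.Ico_subset_Ico le_rfl (by omega)
        subst this
        have := h5 (show v ∈ _ by simp; omega)
        simp at this
  intro k
  induction k with
  | zero =>
    intro hk
    have h1 : Tf b c (Finset.Ico a (a + 0)) (flagH b a 0 G0) ≠ 0 := by
      rw [flagH_zero]; simpa [Tf_empty] using hG0
    exact ⟨h1, aux 0 hk h1⟩
  | succ k ih =>
    intro hk
    have h2 := (ih (by omega)).2
    have hne : Finset.Ico a (a + (k + 1)) ≠ ∅ := by
      rw [← Finset.nonempty_iff_ne_empty]; exact ⟨a, by simp⟩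
    have hsub : ∀ m, m ≤ k + 1 → Finset.Ico a (a + m) ⊆ Finset.Ico a (a + N) :=
      fun m hm => Finset.Ico_subset_Ico le_rfl (by omega)
    have h1 : Tf b c (Finset.Ico a (a + (k + 1))) (flagH b a (k + 1) G0) ≠ 0 := by
      rw [Tf_ne _ _ _ hne, flagH_succ, cone_apply_insert]
      · exact mul_ne_zero (eps_ne _ _) h2
      · unfold flagH
        rw [Finset.mem_union, not_or]
        refine ⟨hfresh _ (hsub _ le_rfl) hne G0 hG0, ?_⟩
        intro hm
        obtain ⟨m, hm, hm'⟩ := Finset.mem_image.1 hm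
        simp only [mem_Ico] at hm
        exact Ico_ne (show m ≠ k + 1 by omega)
          (hinj _ (hsub m (by omega)) _ (hsub _ le_rfl) hm')
    exact ⟨h1, aux _ hk h1⟩

end helpers3

section helpers4
open scoped Classical

variable {K : Type*} [Field K]

def GoodW (K : Type*) [Field K] (j : ℕ) (W : Finset (Finset ℕ)) : Prop :=
  ∀ β : Finset ℕ → ℕ, Function.Injective β → ∃ z : Finset ℕ →₀ K, bdry K z = 0 ∧
    (∀ G, z G ≠ 0 → ∃ C ⊆ W, IsChainF C ∧ G = C.image β ∧ G.card = j) ∧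
    ∃ C0 ⊆ W, z (C0.image β) ≠ 0 ∧ ∀ t ∈ W, t ∉ C0 → ∃ s ∈ C0, ¬ (s ⊆ t ∨ t ⊆ s)

def Wset (a : ℕ → ℕ) (e : ℕ) : Finset (Finset ℕ) :=
  (Finset.range e).biUnion fun i => Finset.Ioo (Finset.range (a i)) (Finset.range (a (i + 1)))

lemma mem_Wset {a : ℕ → ℕ} {e : ℕ} {t : Finset ℕ} :
    t ∈ Wset a e ↔ ∃ i < e, Finset.range (a i) ⊂ t ∧ t ⊂ Finset.range (a (i + 1)) := by
  simp [Wset]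

lemma Wset_sub {a : ℕ → ℕ} (ha : StrictMono a) {e : ℕ} {t : Finset ℕ} (h : t ∈ Wset a e) :
    t ⊂ Finset.range (a e) ∧ t ≠ ∅ := by
  obtain ⟨i, hi, h1, h2⟩ := mem_Wset.1 h
  constructor
  · exact lt_of_lt_of_le h2 (Finset.range_subset_range.2 (ha.monotone (by omega)))
  · rintro rfl; exact Finset.not_ssubset_empty _ h1

lemma Wset_card_notmem {a : ℕ → ℕ} (ha : StrictMono a) {e : ℕ} {t : Finset ℕ} (h : t ∈ Wset a e)
    (k : ℕ) : t.card ≠ a k := by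
  obtain ⟨i, hi, h1, h2⟩ := mem_Wset.1 h
  have h1 := Finset.card_lt_card h1
  have h2 := Finset.card_lt_card h2
  rw [Finset.card_range] at h1 h2
  intro hk
  rw [hk] at h1 h2
  have := ha.lt_iff_lt.1 h1
  have := ha.lt_iff_lt.1 h2
  omega

lemma chain_card_le {a : ℕ → ℕ} (ha : StrictMono a) {e : ℕ} {C : Finset (Finset ℕ)}
    (hC : IsChainF C) (h : C ⊆ Wset a e) : C.card + e ≤ a e := by
  have h1 : Set.InjOn Finset.card (C : Set (Finset ℕ)) := by
    intro s hs t ht hst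
    rcases hC s hs t ht with h | h
    · exact Finset.eq_of_subset_of_card_le h hst.ge
    · exact (Finset.eq_of_subset_of_card_le h hst.le).symm
  rw [← Finset.card_image_of_injOn h1]
  have h2 : ((Finset.range e).image a).card = e := by
    rw [Finset.card_image_of_injective _ ha.injective, Finset.card_range]
  have h3 : Disjoint (C.image Finset.card) ((Finset.range e).image a) := by
    rw [Finset.disjoint_left]
    intro x hx hx'
    obtain ⟨t, ht, rfl⟩ := Finset.mem_image.1 hx
    obtain ⟨k, hk, hk'⟩ := Finset.mem_image.1 hx'
    exact Wset_card_notmem ha (h ht) k hk'.symm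
  have h4 : C.image Finset.card ∪ (Finset.range e).image a ⊆ Finset.range (a e) := by
    intro x hx
    rcases Finset.mem_union.1 hx with hx | hx
    · obtain ⟨t, ht, rfl⟩ := Finset.mem_image.1 hx
      have := Finset.card_lt_card (Wset_sub ha (h ht)).1
      simpa using this
    · obtain ⟨k, hk, rfl⟩ := Finset.mem_image.1 hx
      simp only [mem_range] at hk ⊢
      exact ha hk
  have h5 := Finset.card_le_card h4
  rw [Finset.card_union_of_disjoint h3, h2, Finset.card_range] at h5
  exact h5

lemma bdry_bdryFace (s : Finset ℕ) : bdry K (bdryFace K s) = 0 := by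
  have := bdry_bdry (Finsupp.single s (1:K))
  rwa [bdry_single, one_smul] at this

lemma bdry_single_empty : bdry K (Finsupp.single (∅ : Finset ℕ) (1:K)) = 0 := by
  rw [bdry_single, bdryFace_eq]; simp

lemma join_cycle (a : ℕ → ℕ) (ha : StrictMono a) (h0 : a 0 = 0) (β : Finset ℕ → ℕ)
    (hβ : Function.Injective β) (e : ℕ) : ∃ z : Finset ℕ →₀ K, bdry K z = 0 ∧
    (∀ G, z G ≠ 0 → ∃ C ⊆ Wset a e, IsChainF C ∧ G = C.image β ∧ G.card + e = a e) ∧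
    ∃ G, z G ≠ 0 := by
  induction e with
  | zero =>
    refine ⟨Finsupp.single ∅ 1, bdry_single_empty, ?_, ∅, by simp⟩
    intro G hG
    by_cases h : G = ∅
    · subst h; exact ⟨∅, by simp, by simp [IsChainF], by simp, by simp [h0]⟩
    · simp [Finsupp.single_eq_of_ne h] at hG
  | succ e ih =>
    obtain ⟨c, hc, hs, G0, hG0⟩ := ih
    have hlt : a e < a (e + 1) := ha (by omega)
    obtain ⟨N, hN⟩ : ∃ N, a (e + 1) = a e + (N + 1) := ⟨a (e + 1) - a e - 1, by omega⟩
    set b : Finset ℕ → ℕ := fun t => β (Finset.range (a e) ∪ t) with hb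
    refine ⟨TT b c (bdryFace K (Finset.Ico (a e) (a e + (N + 1)))), ?_, ?_, ?_⟩
    · rw [bdry_TT b c hc, bdry_bdryFace, map_zero]
    · intro G hG
      obtain ⟨G1, C, hG1, hC, hC1, hC2, hC3⟩ := TTb_support hG
      obtain ⟨C1, hC1W, hC1c, hG1e, hG1c⟩ := hs G1 hG1
      refine ⟨C1 ∪ C.image (fun t => Finset.range (a e) ∪ t), ?_, ?_, ?_, ?_⟩
      · intro t ht
        rw [mem_Wset]
        rcases Finset.mem_union.1 ht with ht | ht
        · obtain ⟨i, hi, h⟩ := mem_Wset.1 (hC1W ht)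
          exact ⟨i, by omega, h⟩
        · obtain ⟨u, hu, rfl⟩ := Finset.mem_image.1 ht
          refine ⟨e, by omega, ?_, ?_⟩
          · refine Finset.ssubset_iff_subset_ne.2 ⟨Finset.subset_union_left, fun h => ?_⟩
            obtain ⟨x, hx⟩ := Finset.nonempty_iff_ne_empty.2 (hC1 u hu).2
            have h1 := (hC1 u hu).1.1 hx
            have h2 : x ∈ Finset.range (a e) := by rw [h]; simp [hx]
            simp only [mem_Ico, mem_range] at h1 h2
            omega
          · obtain ⟨h1, h2⟩ := (hC1 u hu).1
            refine ⟨?_, fun h => h2 ?_⟩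
            · intro x hx
              rcases Finset.mem_union.1 hx with hx | hx
              · simp only [mem_range] at hx ⊢; omega
              · have := h1 hx; simp only [mem_Ico, mem_range] at this ⊢; omega
            · intro x hx
              simp only [mem_Ico] at hx
              have := h (show x ∈ Finset.range (a (e + 1)) by simp only [mem_range]; omega)
              rcases Finset.mem_union.1 this with h3 | h3
              · simp only [mem_range] at h3; omega
              · exact h3
      · intro t ht u hu
        rcases Finset.mem_union.1 ht with ht | ht
        · rcases Finset.mem_union.1 hu with hu | hu
          · exact hC1c t ht u hu
          · obtain ⟨u, hu, rfl⟩ := Finset.mem_image.1 hu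
            left; exact (Wset_sub ha (hC1W ht)).1.1.trans Finset.subset_union_left
        · obtain ⟨t, ht1, rfl⟩ := Finset.mem_image.1 ht
          rcases Finset.mem_union.1 hu with hu | hu
          · right; exact (Wset_sub ha (hC1W hu)).1.1.trans Finset.subset_union_left
          · obtain ⟨u, hu1, rfl⟩ := Finset.mem_image.1 hu
            rcases hC t ht1 u hu1 with h | h
            · left; exact Finset.union_subset_union_right h
            · right; exact Finset.union_subset_union_right h
      · rw [hC2, Finset.image_union, hG1e, Finset.image_image]; rfl
      · rw [Nat.card_Ico] at hC3; omega
    · refine ⟨flagH b (a e) N G0, (flag_coeff b c (a e) (N + 1) ?_ ?_ G0 hG0 N le_rfl).2⟩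
      · intro t ht u hu htu
        have := hβ htu
        have key : ∀ t u : Finset ℕ, t ⊆ Finset.Ico (a e) (a e + (N + 1)) →
            Finset.range (a e) ∪ t = Finset.range (a e) ∪ u → t ⊆ u := by
          intro t u ht h x hx
          have h1 := ht hx
          have h2 : x ∈ Finset.range (a e) ∪ u := by rw [← h]; simp [hx]
          simp only [mem_Ico, mem_union, mem_range] at h1 h2
          rcases h2 with h2 | h2
          · omega
          · exact h2
        exact (key t u ht this).antisymm (key u t hu this.symm)
      · intro t ht htn G hG hmem
        obtain ⟨C, hCW, -, rfl, -⟩ := hs G hG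
        obtain ⟨u, hu, hu'⟩ := Finset.mem_image.1 hmem
        have := hβ hu'
        subst this
        exact (Wset_sub ha (hCW hu)).1.2 Finset.subset_union_left

lemma good_join (a : ℕ → ℕ) (ha : StrictMono a) (h0 : a 0 = 0) (e j : ℕ) (hj : j + e = a e) :
    GoodW K j (Wset a e) := by
  intro β hβ
  obtain ⟨z, hz, hs, G, hG⟩ := join_cycle (K := K) a ha h0 β hβ e
  refine ⟨z, hz, ?_, ?_⟩
  · intro G hG
    obtain ⟨C, h1, h2, h3, h4⟩ := hs G hG
    exact ⟨C, h1, h2, h3, by omega⟩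
  · obtain ⟨C, h1, h2, h3, h4⟩ := hs G hG
    refine ⟨C, h1, h3 ▸ hG, ?_⟩
    intro t ht htC
    by_contra hcon
    push Not at hcon
    have hch : IsChainF (insert t C) := by
      intro s hs u hu
      rw [Finset.mem_insert] at hs hu
      rcases hs with rfl | hs
      · rcases hu with rfl | hu
        · left; rfl
        · exact (hcon u hu).symm
      · rcases hu with rfl | hu
        · exact hcon s hs
        · exact h2 s hs u hu
    have := chain_card_le ha hch (Finset.insert_subset ht h1)
    rw [Finset.card_insert_of_notMem htC] at this
    rw [h3, Finset.card_image_of_injective _ hβ] at h4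
    omega

def Ublk (a : ℕ → ℕ) (t : Finset ℕ) : Finset ℕ := t.biUnion fun i => Finset.Ico (a i) (a (i + 1))

lemma mem_Ublk {a : ℕ → ℕ} {t : Finset ℕ} {x : ℕ} :
    x ∈ Ublk a t ↔ ∃ i ∈ t, a i ≤ x ∧ x < a (i + 1) := by simp [Ublk]

lemma start_mem_Ublk {a : ℕ → ℕ} (ha : StrictMono a) {t : Finset ℕ} {i : ℕ} :
    a i ∈ Ublk a t ↔ i ∈ t := by
  rw [mem_Ublk]
  constructor
  · rintro ⟨k, hk, h1, h2⟩
    have := ha.le_iff_le.1 h1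
    have := ha.lt_iff_lt.1 h2
    have : k = i := by omega
    exact this ▸ hk
  · intro h; exact ⟨i, h, le_rfl, ha (by omega)⟩

lemma Ublk_Ico {a : ℕ → ℕ} (ha : StrictMono a) (h0 : a 0 = 0) (m : ℕ) :
    Ublk a (Finset.Ico 0 (0 + m)) = Finset.range (a m) := by
  induction m with
  | zero => simp [Ublk, h0]
  | succ m ih =>
    ext x
    rw [mem_Ublk]
    simp only [mem_range, mem_Ico]
    have hlt : a m < a (m + 1) := ha (by omega)
    constructor
    · rintro ⟨i, hi, h1, h2⟩
      exact lt_of_lt_of_le h2 (ha.monotone (by omega))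
    · intro hx
      by_cases h : x < a m
      · have : x ∈ Ublk a (Finset.Ico 0 (0 + m)) := by rw [ih]; simpa using h
        obtain ⟨i, hi, h'⟩ := mem_Ublk.1 this
        simp only [mem_Ico] at hi
        exact ⟨i, by omega, h'⟩
      · exact ⟨m, by omega, by omega, hx⟩

lemma Ublk_mono {a : ℕ → ℕ} {s t : Finset ℕ} (h : s ⊆ t) : Ublk a s ⊆ Ublk a t :=
  Finset.biUnion_subset_biUnion_of_subset_left _ h

lemma Ublk_inj {a : ℕ → ℕ} (ha : StrictMono a) : Function.Injective (Ublk a) := by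
  intro s t h
  ext i
  rw [← start_mem_Ublk ha (t := s), ← start_mem_Ublk ha (t := t), h]

lemma Ublk_notMem_Wset {a : ℕ → ℕ} (ha : StrictMono a) (t : Finset ℕ) (e : ℕ) :
    Ublk a t ∉ Wset a e := by
  intro h
  obtain ⟨i, hi, h1, h2⟩ := mem_Wset.1 h
  by_cases hit : i ∈ t
  · apply h2.2
    intro x hx
    by_cases hx' : x < a i
    · exact h1.1 (by simpa using hx')
    · exact mem_Ublk.2 ⟨i, hit, by omega, by simpa using hx⟩
  · apply h1.2
    intro x hx
    have hx2 := h2.1 hx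
    obtain ⟨k, hk, h3, h4⟩ := mem_Ublk.1 hx
    simp only [mem_range] at hx2 ⊢
    have : k < i + 1 := ha.lt_iff_lt.1 (lt_of_le_of_lt h3 hx2)
    have : k ≠ i := fun h => hit (h ▸ hk)
    exact lt_of_lt_of_le h4 (ha.monotone (by omega))

lemma good_compl (a : ℕ → ℕ) (ha : StrictMono a) (h0 : a 0 = 0) (j : ℕ) :
    GoodW K j (Finset.Ioo ∅ (Finset.range (a (j + 1))) \ Wset a (j + 1)) := by
  intro β hβ
  set b : Finset ℕ → ℕ := fun t => β (Ublk a t) with hb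
  have hbinj : Function.Injective b := hβ.comp (Ublk_inj ha)
  have hc0 : ∀ G : Finset ℕ, (Finsupp.single (∅ : Finset ℕ) (1:K)) G ≠ 0 → G = ∅ := by
    intro G hG
    by_contra h
    simp [Finsupp.single_eq_of_ne h] at hG
  refine ⟨TT b (Finsupp.single ∅ 1) (bdryFace K (Finset.Ico 0 (0 + (j + 1)))), ?_, ?_, ?_⟩
  · rw [bdry_TT b _ bdry_single_empty, bdry_bdryFace, map_zero]
  · intro G hG
    obtain ⟨G1, C, hG1, hC, hC1, hC2, hC3⟩ := TTb_support hG
    have := hc0 _ hG1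
    subst this
    refine ⟨C.image (Ublk a), ?_, ?_, ?_, ?_⟩
    · intro u hu
      obtain ⟨t, ht, rfl⟩ := Finset.mem_image.1 hu
      obtain ⟨h1, h2⟩ := hC1 t ht
      rw [Finset.mem_sdiff, Finset.mem_Ioo]
      refine ⟨⟨?_, ?_⟩, Ublk_notMem_Wset ha _ _⟩
      · obtain ⟨i, hi⟩ := Finset.nonempty_iff_ne_empty.2 h2
        exact Finset.empty_ssubset.2 ⟨a i, (start_mem_Ublk ha).2 hi⟩
      · rw [← Ublk_Ico ha h0]
        exact lt_of_le_of_ne (Ublk_mono h1.1) fun h => h1.ne (Ublk_inj ha h)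
    · intro s hs u hu
      obtain ⟨s, hs1, rfl⟩ := Finset.mem_image.1 hs
      obtain ⟨u, hu1, rfl⟩ := Finset.mem_image.1 hu
      rcases hC s hs1 u hu1 with h | h
      · left; exact Ublk_mono h
      · right; exact Ublk_mono h
    · rw [hC2, Finset.image_image, Finset.empty_union]; rfl
    · rw [Nat.card_Ico] at hC3; simp at hC3; omega
  · refine ⟨(Finset.Ico 1 (j + 1)).image (fun m => Finset.range (a m)), ?_, ?_, ?_⟩
    · intro u hu
      obtain ⟨m, hm, rfl⟩ := Finset.mem_image.1 hu
      simp only [mem_Ico] at hm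
      rw [Finset.mem_sdiff, Finset.mem_Ioo]
      refine ⟨⟨?_, ?_⟩, ?_⟩
      · have : a 0 < a m := ha (by omega)
        exact Finset.empty_ssubset.2 ⟨0, by simp; omega⟩
      · have : a m < a (j + 1) := ha (by omega)
        refine Finset.ssubset_iff_subset_ne.2 ⟨Finset.range_subset_range.2 this.le, fun h => ?_⟩
        have := congrArg Finset.card h
        simp at this; omega
      · rw [← Ublk_Ico ha h0]; exact Ublk_notMem_Wset ha _ _
    · have := (flag_coeff b (Finsupp.single (∅ : Finset ℕ) (1:K)) 0 (j + 1)
        (fun t _ u _ h => hbinj h) (fun t _ _ G hG => by rw [hc0 G hG]; simp) ∅ (by simp) j le_rfl).2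
      convert this using 2
      unfold flagH
      rw [Finset.image_image, Finset.empty_union]
      refine Finset.image_congr fun m _ => ?_
      simp only [hb, Function.comp, Ublk_Ico ha h0]
    · intro t ht htC
      by_contra hcon
      push Not at hcon
      rw [Finset.mem_sdiff, Finset.mem_Ioo] at ht
      obtain ⟨⟨ht1, ht2⟩, ht3⟩ := ht
      apply ht3
      have hex : ∃ i, ¬ Finset.range (a (i + 1)) ⊆ t := ⟨j, fun h => ht2.2 h⟩
      have hsp := Nat.find_spec hex
      have hmin := fun k (hk : k < Nat.find hex) => Nat.find_min hex hk
      have hle : Nat.find hex ≤ j := Nat.find_min' hex (fun h => ht2.2 h)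
      set i := Nat.find hex with hi
      rw [mem_Wset]
      refine ⟨i, by omega, ?_, ?_⟩
      · rcases Nat.eq_zero_or_pos i with h | h
        · rw [h, h0]; exact ht1
        · have h1 := hmin (i - 1) (by omega)
          rw [not_not, Nat.sub_add_cancel h] at h1
          refine Finset.ssubset_iff_subset_ne.2 ⟨h1, fun h2 => htC ?_⟩
          exact Finset.mem_image.2 ⟨i, by simp only [mem_Ico]; omega, h2⟩
      · by_cases hij : i = j
        · rw [hij]; exact ht2
        · have h3 := hcon (Finset.range (a (i + 1)))
            (Finset.mem_image.2 ⟨i + 1, by simp only [mem_Ico]; omega, rfl⟩)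
          rcases h3 with h3 | h3
          · exact absurd h3 hsp
          · exact ⟨h3, hsp⟩

end helpers4

section helpers5
open scoped Classical

variable {K : Type*} [Field K]

def aseq (q p i : ℕ) : ℕ := i * q + min i p

lemma aseq_succ (q p i : ℕ) : aseq q p (i + 1) = aseq q p i + (if i < p then q + 1 else q) := by
  unfold aseq
  split_ifs with h
  · rw [min_eq_left (by omega), min_eq_left (by omega)]; ring
  · rw [min_eq_right (by omega), min_eq_right (by omega)]; ring

lemma aseq_strictMono {q : ℕ} (hq : 1 ≤ q) (p : ℕ) : StrictMono (aseq q p) := by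
  apply strictMono_nat_of_lt_succ
  intro i
  rw [aseq_succ]; split_ifs <;> omega

lemma sum_aseq (q p k : ℕ) :
    ∑ i ∈ Finset.range k, 2 ^ (aseq q p (i + 1) - aseq q p i) = 2 ^ q * (k + min k p) := by
  induction k with
  | zero => simp
  | succ k ih =>
    rw [Finset.sum_range_succ, ih, aseq_succ, Nat.add_sub_cancel_left]
    split_ifs with h
    · rw [min_eq_left (by omega), min_eq_left (by omega), pow_succ]; ring
    · rw [min_eq_right (by omega), min_eq_right (by omega)]; ring

lemma card_Wset {a : ℕ → ℕ} (ha : StrictMono a) (e : ℕ) :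
    (Wset a e).card + 2 * e = ∑ i ∈ Finset.range e, 2 ^ (a (i + 1) - a i) := by
  have h1 : (Wset a e).card = ∑ i ∈ Finset.range e, (2 ^ (a (i + 1) - a i) - 2) := by
    unfold Wset
    rw [Finset.card_biUnion]
    · refine Finset.sum_congr rfl fun i hi => ?_
      rw [Finset.card_Ioo_finset (Finset.range_subset_range.2 (ha.monotone (by omega)))]
      simp
    · intro i _ k _ hik
      rw [Function.onFun, Finset.disjoint_left]
      intro t ht ht'
      rw [Finset.mem_Ioo] at ht ht'
      have h1 := Finset.card_lt_card ht.1
      have h2 := Finset.card_lt_card ht.2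
      have h3 := Finset.card_lt_card ht'.1
      have h4 := Finset.card_lt_card ht'.2
      rw [Finset.card_range] at h1 h2 h3 h4
      have := ha.lt_iff_lt.1 (h1.trans h4)
      have := ha.lt_iff_lt.1 (h3.trans h2)
      omega
  rw [h1]
  have h2 : 2 * e = ∑ i ∈ Finset.range e, 2 := by simp [mul_comm]
  rw [h2, ← Finset.sum_add_distrib]
  refine Finset.sum_congr rfl fun i _ => ?_
  have : a i < a (i + 1) := ha (by omega)
  have : 2 ^ 1 ≤ 2 ^ (a (i + 1) - a i) := Nat.pow_le_pow_right (by omega) (by omega)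
  omega

lemma mj_eq {d j : ℕ} (hj : j < d) :
    mj d j + j + 2 * (d - j) = 2 ^ (d / (d - j)) * ((d - j) + d % (d - j)) := by
  obtain ⟨e, he, rfl⟩ : ∃ e, 1 ≤ e ∧ d = j + e := ⟨d - j, by omega, by omega⟩
  have e1 : j + e - j = e := by omega
  unfold mj
  rw [e1]
  split_ifs with h
  · rcases Nat.lt_or_ge j e with h1 | h1
    · have h2 : (j + e) / e = 1 := by
        rw [Nat.add_div_right _ (by omega), Nat.div_eq_of_lt h1]
      have h3 : (j + e) % e = j := by
        rw [Nat.add_mod_right, Nat.mod_eq_of_lt h1]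
      rw [h2, h3]; ring
    · have : j = e := by omega
      subst this
      have h2 : (j + j) / j = 2 := by
        rw [Nat.add_div_right _ (by omega), Nat.div_self (by omega)]
      have h3 : (j + j) % j = 0 := by simp
      rw [h2, h3]; ring
  · obtain ⟨k, rfl⟩ : ∃ k, j = e + k := ⟨j - e, by omega⟩
    have h1 : 2 * (e + k) - (e + k + e) = k := by omega
    have h2 : (e + k + e) / e = k / e + 2 := by
      rw [Nat.add_div_right _ (by omega), Nat.add_comm e k, Nat.add_div_right _ (by omega)]
    have h3 : (e + k + e) % e = k % e := by
      rw [Nat.add_mod_right, Nat.add_mod_left]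
    rw [h1, h2, h3]
    have h4 : k / e + 2 ≤ 2 ^ (k / e + 1) := Nat.lt_two_pow_self
    have h5 : 2 ^ (k / e + 2) = 2 * 2 ^ (k / e + 1) := by rw [pow_succ]; ring
    have h6 : k = e * (k / e) + k % e := (Nat.div_add_mod k e).symm
    have h7 : 2 * (e + k + e) ≤ 2 ^ (k / e + 2) * (k % e + e) := by
      generalize k / e = q at *
      generalize k % e = p at *
      generalize 2 ^ (q + 1) = P at *
      rw [h5, h6]
      nlinarith [Nat.mul_le_mul_right (p + e) h4]
    have h8 : 2 ^ (k / e + 2) * (k % e + e) = 2 ^ (k / e + 2) * (e + k % e) := by ring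
    omega

lemma exists_good_min {d j : ℕ} (hj : j < d) : ∃ W ⊆ Finset.Ioo ∅ (Finset.range d),
    GoodW K j W ∧ W.card = mj d j + j := by
  have he : 1 ≤ d - j := by omega
  have hq : 1 ≤ d / (d - j) := Nat.div_pos (by omega) (by omega)
  have ha := aseq_strictMono hq (d % (d - j))
  have hlt := Nat.mod_lt d (show d - j > 0 by omega)
  have had : aseq (d / (d - j)) (d % (d - j)) (d - j) = d := by
    unfold aseq
    rw [min_eq_right hlt.le]
    exact Nat.div_add_mod d (d - j)
  refine ⟨Wset (aseq (d / (d - j)) (d % (d - j))) (d - j), ?_, ?_, ?_⟩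
  · intro t ht
    obtain ⟨h1, h2⟩ := Wset_sub ha ht
    rw [had] at h1
    exact Finset.mem_Ioo.2 ⟨Finset.empty_ssubset.2 (Finset.nonempty_iff_ne_empty.2 h2), h1⟩
  · exact good_join _ ha (by simp [aseq]) _ _ (by rw [had]; omega)
  · have h1 := card_Wset ha (d - j)
    rw [sum_aseq, min_eq_right hlt.le, ← mj_eq hj] at h1
    omega

lemma exists_good_max {d j : ℕ} (hj : j < d) : ∃ W ⊆ Finset.Ioo ∅ (Finset.range d),
    GoodW K j W ∧ W.card + (mj d (d - j - 1) + (d - j - 1)) = 2 ^ d - 2 := by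
  have hj' : d - j - 1 < d := by omega
  have hee : d - (d - j - 1) = j + 1 := by omega
  have hq : 1 ≤ d / (j + 1) := Nat.div_pos (by omega) (by omega)
  have ha := aseq_strictMono hq (d % (j + 1))
  have hlt := Nat.mod_lt d (show j + 1 > 0 by omega)
  have had : aseq (d / (j + 1)) (d % (j + 1)) (j + 1) = d := by
    unfold aseq
    rw [min_eq_right hlt.le]
    exact Nat.div_add_mod d (j + 1)
  refine ⟨Finset.Ioo ∅ (Finset.range d) \ Wset (aseq (d / (j + 1)) (d % (j + 1))) (j + 1), ?_, ?_, ?_⟩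
  · exact Finset.sdiff_subset
  · have := good_compl (K := K) _ ha (by simp [aseq]) j
    rwa [had] at this
  · have h1 := card_Wset ha (j + 1)
    have h2 := mj_eq hj'
    rw [hee] at h2
    rw [sum_aseq, min_eq_right hlt.le, ← h2] at h1
    have hsub : Wset (aseq (d / (j + 1)) (d % (j + 1))) (j + 1) ⊆ Finset.Ioo ∅ (Finset.range d) := by
      intro t ht
      obtain ⟨h1, h2⟩ := Wset_sub ha ht
      rw [had] at h1
      exact Finset.mem_Ioo.2 ⟨Finset.empty_ssubset.2 (Finset.nonempty_iff_ne_empty.2 h2), h1⟩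
    rw [Finset.card_sdiff_of_subset hsub]
    have h3 := Finset.card_le_card hsub
    have h4 : (Finset.Ioo ∅ (Finset.range d)).card = 2 ^ d - 2 := by
      rw [Finset.card_Ioo_finset (by simp)]; simp
    omega

end helpers5

section helpers6
open scoped Classical

lemma enc_inj : Function.Injective enc := Encodable.encode_injective

lemma enc_mem_image {C : Finset (Finset ℕ)} {s : Finset ℕ} : enc s ∈ C.image enc ↔ s ∈ C := by
  rw [Finset.mem_image]
  constructor
  · rintro ⟨t, ht, h⟩
    rwa [← enc_inj h]
  · intro h; exact ⟨s, h, rfl⟩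

lemma mem_sd {Δ : SC} {G : Finset ℕ} :
    G ∈ sd Δ ↔ ∃ C : Finset (Finset ℕ), (∀ s ∈ C, s ∈ Δ ∧ s ≠ ∅) ∧ IsChainF C ∧ G = C.image enc := by
  unfold sd
  simp only [Finset.mem_image, Finset.mem_filter, Finset.mem_powerset]
  constructor
  · rintro ⟨C, ⟨h1, h2⟩, rfl⟩
    exact ⟨C, fun s hs => ⟨Finset.mem_of_mem_erase (h1 hs), Finset.ne_of_mem_erase (h1 hs)⟩, h2, rfl⟩
  · rintro ⟨C, h1, h2, rfl⟩
    exact ⟨C, ⟨fun s hs => Finset.mem_erase.2 ⟨(h1 s hs).2, (h1 s hs).1⟩, h2⟩, rfl⟩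

lemma image_mem_sd {Δ : SC} {C : Finset (Finset ℕ)} :
    C.image enc ∈ sd Δ ↔ (∀ s ∈ C, s ∈ Δ ∧ s ≠ ∅) ∧ IsChainF C := by
  rw [mem_sd]
  constructor
  · rintro ⟨D, h1, h2, h3⟩
    rw [Finset.image_injective enc_inj h3]
    exact ⟨h1, h2⟩
  · rintro ⟨h1, h2⟩; exact ⟨C, h1, h2, rfl⟩

lemma empty_mem_sd (Δ : SC) : ∅ ∈ sd Δ := by
  rw [mem_sd]; exact ⟨∅, by simp, by simp [IsChainF], by simp⟩

lemma vertexSet_sd (Δ : SC) : vertexSet (sd Δ) = (Δ.erase ∅).image enc := by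
  ext v
  rw [mem_vertexSet, Finset.mem_image]
  constructor
  · rintro ⟨s, hs, hv⟩
    obtain ⟨C, h1, h2, rfl⟩ := mem_sd.1 hs
    obtain ⟨t, ht, rfl⟩ := Finset.mem_image.1 hv
    exact ⟨t, Finset.mem_erase.2 ⟨(h1 t ht).2, (h1 t ht).1⟩, rfl⟩
  · rintro ⟨t, ht, rfl⟩
    obtain ⟨h1, h2⟩ := Finset.mem_erase.1 ht
    refine ⟨({t} : Finset (Finset ℕ)).image enc, image_mem_sd.2 ⟨?_, ?_⟩, by simp⟩
    · simp [h1, h2]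
    · simp [IsChainF]

lemma nverts_sd (Δ : SC) : nverts (sd Δ) = (Δ.erase ∅).card := by
  unfold nverts
  rw [vertexSet_sd, Finset.card_image_of_injective _ enc_inj]

lemma isComplex_sd (Δ : SC) : IsComplex (sd Δ) := by
  intro s hs t ht
  obtain ⟨C, h1, h2, rfl⟩ := mem_sd.1 hs
  obtain ⟨D, hD, rfl⟩ := Finset.subset_image_iff.1 ht
  refine image_mem_sd.2 ⟨fun s hs => h1 s (hD hs), fun s hs t ht => h2 s (hD hs) t (hD ht)⟩

lemma exists_chain (x : ℕ) (T : Finset ℕ) (hx : x ∉ T) : ∃ C : Finset (Finset ℕ), IsChainF C ∧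
    C.card = T.card + 1 ∧ insert x T ∈ C ∧ ∀ s ∈ C, s ⊆ insert x T ∧ x ∈ s := by
  induction T using Finset.induction with
  | empty => exact ⟨{{x}}, by simp [IsChainF], by simp, by simp, by simp⟩
  | insert a T ha ih =>
    obtain ⟨C, h1, h2, h3, h4⟩ := ih (fun h => hx (Finset.mem_insert_of_mem h))
    have hax : a ≠ x := fun h => hx (by simp [h])
    have hsub : insert x T ⊆ insert x (insert a T) :=
      Finset.insert_subset_insert _ (Finset.subset_insert _ _)
    have hn : insert x (insert a T) ∉ C := fun h => by
      have := (h4 _ h).1 (show a ∈ insert x (insert a T) by simp)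
      simp [hax, ha] at this
    refine ⟨insert (insert x (insert a T)) C, ?_, ?_, by simp, ?_⟩
    · intro s hs t ht
      rcases Finset.mem_insert.1 hs with rfl | hs
      · rcases Finset.mem_insert.1 ht with rfl | ht
        · exact Or.inl subset_rfl
        · exact Or.inr ((h4 t ht).1.trans hsub)
      · rcases Finset.mem_insert.1 ht with rfl | ht
        · exact Or.inl ((h4 s hs).1.trans hsub)
        · exact h1 s hs t ht
    · rw [Finset.card_insert_of_notMem hn, Finset.card_insert_of_notMem ha, h2]
    · intro s hs
      rcases Finset.mem_insert.1 hs with rfl | hs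
      · exact ⟨subset_rfl, by simp⟩
      · exact ⟨(h4 s hs).1.trans hsub, (h4 s hs).2⟩

lemma exists_chain' {S : Finset ℕ} {x : ℕ} (hx : x ∈ S) : ∃ C : Finset (Finset ℕ), IsChainF C ∧
    C.card = S.card ∧ S ∈ C ∧ ∀ s ∈ C, s ⊆ S ∧ x ∈ s := by
  obtain ⟨C, h⟩ := exists_chain x (S.erase x) (by simp)
  rw [Finset.insert_erase hx, Finset.card_erase_add_one hx] at h
  exact ⟨C, h⟩

/-- from a face `S` containing `x`, a face of `sd` of the same size, all containing `x`, with top `S` -/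
lemma exists_sd_face {Δ : SC} (hC : IsComplex Δ) {S : Finset ℕ} (hS : S ∈ Δ) {x : ℕ} (hx : x ∈ S) :
    ∃ T ∈ sd Δ, T.card = S.card ∧ enc S ∈ T ∧ ∀ s, enc s ∈ T → s ⊆ S ∧ x ∈ s := by
  obtain ⟨C, h1, h2, h3, h4⟩ := exists_chain' hx
  refine ⟨C.image enc, image_mem_sd.2 ⟨fun s hs => ⟨hC S hS s (h4 s hs).1, ?_⟩, h1⟩, ?_, ?_, ?_⟩
  · exact Finset.nonempty_iff_ne_empty.1 ⟨x, (h4 s hs).2⟩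
  · rw [Finset.card_image_of_injective _ enc_inj, h2]
  · exact enc_mem_image.2 h3
  · intro s hs; exact h4 s (enc_mem_image.1 hs)

lemma exists_face {Δ : SC} {d : ℕ} (hd : 1 ≤ d) (h : Δ.sup Finset.card = d) :
    ∃ F ∈ Δ, F.card = d := by
  have hne : Δ.Nonempty := by
    rw [Finset.nonempty_iff_ne_empty]; rintro rfl; simp at h; omega
  obtain ⟨F, hF, h'⟩ := Finset.exists_mem_eq_sup Δ hne Finset.card
  exact ⟨F, hF, by rw [← h', h]⟩

lemma sup_card_sd {Δ : SC} (hC : IsComplex Δ) {d : ℕ} (hd : 1 ≤ d) (h : Δ.sup Finset.card = d) :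
    (sd Δ).sup Finset.card = d := by
  apply le_antisymm
  · apply Finset.sup_le
    intro G hG
    obtain ⟨C, h1, h2, rfl⟩ := mem_sd.1 hG
    rw [Finset.card_image_of_injective _ enc_inj]
    have hinj : Set.InjOn Finset.card (C : Set (Finset ℕ)) := by
      intro s hs t ht hst
      rcases h2 s hs t ht with h | h
      · exact Finset.eq_of_subset_of_card_le h hst.ge
      · exact (Finset.eq_of_subset_of_card_le h hst.le).symm
    rw [← Finset.card_image_of_injOn hinj]
    have : C.image Finset.card ⊆ Finset.Icc 1 d := by
      intro n hn
      obtain ⟨s, hs, rfl⟩ := Finset.mem_image.1 hn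
      rw [Finset.mem_Icc]
      refine ⟨Finset.card_pos.2 (Finset.nonempty_iff_ne_empty.2 (h1 s hs).2), ?_⟩
      rw [← h]; exact Finset.le_sup (f := Finset.card) (h1 s hs).1
    simpa using Finset.card_le_card this
  · obtain ⟨F, hF, hFd⟩ := exists_face hd h
    obtain ⟨x, hx⟩ := Finset.card_pos.1 (show 0 < F.card by omega)
    obtain ⟨T, hT, h1, -⟩ := exists_sd_face hC hF hx
    rw [← hFd, ← h1]; exact Finset.le_sup (f := Finset.card) hT

lemma iterate_sd {Δ : SC} (hC : IsComplex Δ) {d : ℕ} (hd : 1 ≤ d) (h : Δ.sup Finset.card = d)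
    (n : ℕ) : IsComplex (sd^[n] Δ) ∧ (sd^[n] Δ).sup Finset.card = d := by
  induction n with
  | zero => exact ⟨hC, h⟩
  | succ n ih =>
    rw [Function.iterate_succ_apply']
    exact ⟨isComplex_sd _, sup_card_sd ih.1 hd ih.2⟩

/-! relabelling -/
lemma exists_lift (σ : Equiv.Perm ℕ) : ∃ σ' : Equiv.Perm ℕ, ∀ s, σ' (enc s) = enc (s.image σ) := by
  refine ⟨Equiv.Perm.viaEmbedding (Equiv.finsetCongr σ : Equiv.Perm (Finset ℕ)) ⟨enc, enc_inj⟩, fun s => ?_⟩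
  have := Equiv.Perm.viaEmbedding_apply (Equiv.finsetCongr σ : Equiv.Perm (Finset ℕ)) ⟨enc, enc_inj⟩ s
  simp only [Function.Embedding.coeFn_mk] at this
  rw [this, Equiv.finsetCongr_apply, Finset.map_eq_image]; rfl

lemma sd_relabel_sub (σ σ' : Equiv.Perm ℕ) (h : ∀ s, σ' (enc s) = enc (s.image σ)) (Δ : SC)
    {G : Finset ℕ} (hG : G ∈ sd Δ) : G.image σ' ∈ sd (Δ.image (fun s => s.image σ)) := by
  obtain ⟨C, h1, h2, rfl⟩ := mem_sd.1 hG
  rw [mem_sd]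
  refine ⟨C.image (fun s => s.image σ), ?_, ?_, ?_⟩
  · intro s hs
    obtain ⟨t, ht, rfl⟩ := Finset.mem_image.1 hs
    exact ⟨Finset.mem_image_of_mem _ (h1 t ht).1, by simpa using (h1 t ht).2⟩
  · intro s hs t ht
    obtain ⟨s', hs', rfl⟩ := Finset.mem_image.1 hs
    obtain ⟨t', ht', rfl⟩ := Finset.mem_image.1 ht
    rcases h2 s' hs' t' ht' with h | h
    · exact Or.inl (Finset.image_subset_image h)
    · exact Or.inr (Finset.image_subset_image h)
  · rw [Finset.image_image, Finset.image_image]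
    exact Finset.image_congr (fun s _ => h s)

lemma sd_relabel (σ σ' : Equiv.Perm ℕ) (h : ∀ s, σ' (enc s) = enc (s.image σ)) (Δ : SC) :
    sd (Δ.image (fun s => s.image σ)) = (sd Δ).image (fun s => s.image σ') := by
  have key : ∀ (σ : Equiv.Perm ℕ) (s : Finset ℕ), (s.image σ).image σ.symm = s := by
    intro σ s; rw [Finset.image_image]; simp
  have key2 : ∀ (σ : Equiv.Perm ℕ) (s : Finset ℕ), (s.image σ.symm).image σ = s := by
    intro σ s; rw [Finset.image_image]; simp
  ext G
  constructor
  · intro hG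
    have h' : ∀ s, σ'.symm (enc s) = enc (s.image σ.symm) := by
      intro s
      rw [Equiv.symm_apply_eq, h, key2]
    have := sd_relabel_sub σ.symm σ'.symm h' _ hG
    rw [Finset.image_image] at this
    have e : (fun s : Finset ℕ => s.image σ.symm) ∘ (fun s : Finset ℕ => s.image σ) = id := by
      funext s; simp only [Function.comp]; exact key σ s
    rw [e, Finset.image_id] at this
    exact Finset.mem_image.2 ⟨_, this, key2 σ' G⟩
  · intro hG
    obtain ⟨H, hH, rfl⟩ := Finset.mem_image.1 hG
    exact sd_relabel_sub σ σ' h Δ hH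

lemma exists_perm {d : ℕ} {F : Finset ℕ} (hF : F.card = d) :
    ∃ σ : Equiv.Perm ℕ, (Finset.range d).image σ = F := by
  obtain ⟨σ, hσ⟩ := (Equiv.Perm.isMultiplyPretransitive ℕ d).exists_smul_eq
    (Fin.valEmbedding : Fin d ↪ ℕ) (F.orderEmbOfFin hF).toEmbedding
  refine ⟨σ, ?_⟩
  ext y
  have h : ∀ i : Fin d, σ i = F.orderEmbOfFin hF i := fun i => DFunLike.congr_fun hσ i
  constructor
  · intro hy
    obtain ⟨x, hx, rfl⟩ := Finset.mem_image.1 hy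
    have := h ⟨x, Finset.mem_range.1 hx⟩
    simp only at this
    rw [this]; exact Finset.orderEmbOfFin_mem _ _ _
  · intro hy
    have : y ∈ Set.range (F.orderEmbOfFin hF) := by rw [Finset.range_orderEmbOfFin]; exact hy
    obtain ⟨i, rfl⟩ := this
    rw [← h i]
    exact Finset.mem_image_of_mem _ (by simp)

lemma Nd_eq0 (d : ℕ) :
    Nd d = (sd (sd (simplexC d)) \ sd (sd (boundaryC d))).card := by
  unfold Nd
  rw [Function.iterate_succ_apply', Function.iterate_succ_apply', Function.iterate_one,
    Function.iterate_succ_apply', Function.iterate_succ_apply', Function.iterate_one]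
  rw [vertexSet_sd, vertexSet_sd, ← Finset.image_sdiff _ _ enc_inj,
    Finset.card_image_of_injective _ enc_inj]
  have := empty_mem_sd (sd (boundaryC d))
  generalize sd (sd (boundaryC d)) = A at this ⊢
  generalize sd (sd (simplexC d)) = B
  congr 1
  ext s
  simp only [Finset.mem_sdiff, Finset.mem_erase]
  constructor
  · rintro ⟨⟨h1, h2⟩, h3⟩; exact ⟨h2, fun h => h3 ⟨h1, h⟩⟩
  · rintro ⟨h1, h2⟩
    exact ⟨⟨fun h => h2 (h ▸ this), h1⟩, fun h => h2 h.2⟩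

lemma Nd_eq {d : ℕ} {F : Finset ℕ} (hF : F.card = d) :
    Nd d = (sd (sd F.powerset) \ sd (sd (F.powerset.erase F))).card := by
  obtain ⟨σ, rfl⟩ := exists_perm hF
  obtain ⟨σ', h'⟩ := exists_lift σ
  obtain ⟨σ'', h''⟩ := exists_lift σ'
  have i1 : Function.Injective (fun s : Finset ℕ => s.image σ) := Finset.image_injective σ.injective
  have i2 : Function.Injective (fun s : Finset ℕ => s.image σ'') := Finset.image_injective σ''.injective
  have e1 : ((Finset.range d).image σ).powerset = (simplexC d).image (fun s => s.image σ) := by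
    ext t
    rw [Finset.mem_powerset, Finset.subset_image_iff]
    simp [simplexC]
  have e2 : ((Finset.range d).image σ).powerset.erase ((Finset.range d).image σ)
      = (boundaryC d).image (fun s => s.image σ) := by
    rw [e1]; unfold boundaryC simplexC
    rw [Finset.image_erase i1]
  have e3 : sd (sd ((simplexC d).image (fun s => s.image σ))) =
      (sd (sd (simplexC d))).image (fun s => s.image σ'') := by
    rw [sd_relabel σ σ' h', sd_relabel σ' σ'' h'']
  have e4 : sd (sd ((boundaryC d).image (fun s => s.image σ))) =
      (sd (sd (boundaryC d))).image (fun s => s.image σ'') := by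
    rw [sd_relabel σ σ' h', sd_relabel σ' σ'' h'']
  rw [e2, e1, e3, e4, Nd_eq0]
  generalize sd (sd (boundaryC d)) = A
  generalize sd (sd (simplexC d)) = B
  rw [← Finset.image_sdiff _ _ i2, Finset.card_image_of_injective _ i2]

end helpers6

section helpers7
open scoped Classical

lemma interior_of_meets {Δ : SC} {F : Finset ℕ}
    (hmax : ∀ E ∈ Δ, F ⊆ E → E = F) {s : Finset ℕ} (hs : s ∈ sd (sd Δ))
    {c : Finset ℕ} (hcs : enc c ∈ s) (hFc : enc F ∈ c) :
    s ∈ sd (sd F.powerset) \ sd (sd (F.powerset.erase F)) := by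
  rw [Finset.mem_sdiff]
  constructor
  · obtain ⟨C, h1, h2, rfl⟩ := mem_sd.1 hs
    rw [enc_mem_image] at hcs
    refine image_mem_sd.2 ⟨fun c' hc' => ⟨?_, (h1 c' hc').2⟩, h2⟩
    obtain ⟨D', a1, a2, rfl⟩ := mem_sd.1 (h1 c' hc').1
    obtain ⟨D, b1, b2, rfl⟩ := mem_sd.1 (h1 c hcs).1
    rw [enc_mem_image] at hFc
    refine image_mem_sd.2 ⟨fun E hE => ⟨?_, (a1 E hE).2⟩, a2⟩
    rw [Finset.mem_powerset]
    have hcomp : E ⊆ F ∨ F ⊆ E := by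
      rcases h2 _ hcs _ hc' with h | h
      · have : F ∈ D' := enc_mem_image.1 (h (enc_mem_image.2 hFc))
        exact a2 E hE F this
      · have : E ∈ D := enc_mem_image.1 (h (enc_mem_image.2 hE))
        exact b2 E this F hFc
    rcases hcomp with h | h
    · exact h
    · rw [hmax E (a1 E hE).1 h]
  · intro h
    obtain ⟨C, h1, h2, rfl⟩ := mem_sd.1 h
    rw [enc_mem_image] at hcs
    obtain ⟨D, b1, b2, rfl⟩ := mem_sd.1 (h1 c hcs).1
    rw [enc_mem_image] at hFc
    simpa using (b1 F hFc).1

lemma pair_mem_sd {Δ : SC} {F G : Finset ℕ} (hG : G ∈ Δ) (hF : F ∈ Δ) (h0 : G ≠ ∅) (h1 : F ≠ ∅)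
    (h : G ⊆ F) : ({enc G, enc F} : Finset ℕ) ∈ sd Δ := by
  have : ({enc G, enc F} : Finset ℕ) = ({G, F} : Finset (Finset ℕ)).image enc := by
    simp [Finset.image_insert]
  rw [this]
  refine image_mem_sd.2 ⟨by simp [*], ?_⟩
  intro s hs t ht
  simp only [Finset.mem_insert, Finset.mem_singleton] at hs ht
  rcases hs with rfl | rfl <;> rcases ht with rfl | rfl <;> simp [h]

lemma single_mem_sd {Δ : SC} {G : Finset ℕ} (hG : G ∈ Δ) (h0 : G ≠ ∅) :
    ({enc G} : Finset ℕ) ∈ sd Δ := by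
  simpa using pair_mem_sd hG hG h0 h0 subset_rfl

lemma pair_inj {a b f : ℕ} (ha : a ≠ f) (h : ({a, f} : Finset ℕ) ⊆ {b, f}) : a = b := by
  have := h (show a ∈ ({a, f} : Finset ℕ) by simp)
  simpa [ha] using this

lemma pair_ne_single {a b f : ℕ} (hb : b ≠ f) (h : ({b, f} : Finset ℕ) = {a}) : False := by
  have h1 : b ∈ ({a} : Finset ℕ) := h ▸ (by simp)
  have h2 : f ∈ ({a} : Finset ℕ) := h ▸ (by simp)
  simp at h1 h2
  exact hb (h1.trans h2.symm)

lemma pow_ge (d : ℕ) (hd : 2 ≤ d) : d + 2 ≤ 2 ^ d := by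
  induction d, hd using Nat.le_induction with
  | base => norm_num
  | succ n hn ih => rw [pow_succ]; omega

lemma setup {Δ : SC} (hC : IsComplex Δ) {d : ℕ} (hd : 2 ≤ d) (hdim : Δ.sup Finset.card = d) :
    ∃ τ ∈ sd (sd Δ), τ.card = d ∧
      ((sd (sd Δ)).filter (fun s => ¬ Disjoint s τ)).card + d ≤ Nd d ∧
      2 ^ d - 2 ≤ (((sd (sd Δ)).filter (fun s => Disjoint s τ)).erase ∅).card := by
  obtain ⟨F, hF, hFd⟩ := exists_face (by omega) hdim
  have hmax : ∀ E ∈ Δ, F ⊆ E → E = F := by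
    intro E hE h
    have : E.card ≤ d := by rw [← hdim]; exact Finset.le_sup (f := Finset.card) hE
    exact (Finset.eq_of_subset_of_card_le h (by omega)).symm
  obtain ⟨x, hx⟩ := Finset.card_pos.1 (show 0 < F.card by omega)
  have hF0 : F ≠ ∅ := Finset.nonempty_iff_ne_empty.1 ⟨x, hx⟩
  obtain ⟨D, hD, hDc, hFD, -⟩ := exists_sd_face hC hF hx
  obtain ⟨τ, hτ, hτc, -, hτF⟩ := exists_sd_face (isComplex_sd Δ) hD hFD
  have hτF' : ∀ c, enc c ∈ τ → enc F ∈ c := fun c hc => (hτF c hc).2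
  have hτe : ∀ v ∈ τ, ∃ c, v = enc c := by
    intro v hv
    obtain ⟨C, -, -, rfl⟩ := mem_sd.1 hτ
    obtain ⟨c, -, rfl⟩ := Finset.mem_image.1 hv
    exact ⟨c, rfl⟩
  have hτch : ∀ c c', enc c ∈ τ → enc c' ∈ τ → c ⊆ c' ∨ c' ⊆ c := by
    intro c c' hc hc'
    obtain ⟨C, -, h, rfl⟩ := mem_sd.1 hτ
    exact h c (enc_mem_image.1 hc) c' (enc_mem_image.1 hc')
  refine ⟨τ, hτ, by omega, ?_, ?_⟩
  · rw [Nd_eq hFd]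
    set P := (Finset.Ioo ∅ F) with hP
    have hPm : ∀ G ∈ P, G ≠ ∅ ∧ G ⊆ F ∧ G ≠ F ∧ enc G ≠ enc F := by
      intro G hG
      rw [hP, Finset.mem_Ioo] at hG
      exact ⟨hG.1.ne', hG.2.le, hG.2.ne, fun h => hG.2.ne (enc_inj h)⟩
    have hPc : P.card = 2 ^ d - 2 := by
      rw [hP, Finset.card_Ioo_finset (by simp), hFd]; simp
    set P' := P.filter (fun G => enc {enc G, enc F} ∉ τ) with hP'
    have hbad : (P.filter (fun G => ¬ enc {enc G, enc F} ∉ τ)).card ≤ 1 := by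
      rw [Finset.card_le_one]
      intro a ha b hb
      simp only [Finset.mem_filter, not_not] at ha hb
      rcases hτch _ _ ha.2 hb.2 with h | h
      · exact enc_inj (pair_inj (hPm a ha.1).2.2.2 h)
      · exact (enc_inj (pair_inj (hPm b hb.1).2.2.2 h)).symm
    have hsplit : P'.card + (P.filter (fun G => ¬ enc {enc G, enc F} ∉ τ)).card = P.card :=
      Finset.card_filter_add_card_filter_not (s := P) (fun G => enc {enc G, enc F} ∉ τ)
    have hP'm : ∀ G ∈ P', (G ≠ ∅ ∧ G ⊆ F ∧ G ≠ F ∧ enc G ≠ enc F) ∧ enc {enc G, enc F} ∉ τ := by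
      intro G hG
      rw [hP', Finset.mem_filter] at hG
      exact ⟨hPm G hG.1, hG.2⟩
    let A : Finset ℕ → Finset ℕ := fun G => {enc {enc G, enc F}}
    let B : Finset ℕ → Finset ℕ := fun G => {enc {enc G}, enc {enc G, enc F}}
    have hAinj : Set.InjOn A (P' : Set (Finset ℕ)) := by
      intro a ha b hb h
      have h' := enc_inj (Finset.singleton_injective h)
      exact enc_inj (pair_inj (hP'm a ha).1.2.2.2 h'.le)
    have hBinj : Set.InjOn B (P' : Set (Finset ℕ)) := by
      intro a ha b hb h
      have h1 : enc {enc a} ∈ B b := by rw [← h]; simp [B]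
      simp only [B, Finset.mem_insert, Finset.mem_singleton] at h1
      rcases h1 with h1 | h1
      · exact enc_inj (Finset.singleton_injective (enc_inj h1))
      · exact (pair_ne_single (hP'm b hb).1.2.2.2 (enc_inj h1).symm).elim
    have hBc : ∀ G ∈ P', (B G).card = 2 := by
      intro G hG
      refine Finset.card_pair (fun h => ?_)
      exact pair_ne_single (hP'm G hG).1.2.2.2 (enc_inj h).symm
    have hAB : Disjoint (P'.image A) (P'.image B) := by
      rw [Finset.disjoint_left]
      intro s hs hs'
      obtain ⟨a, -, rfl⟩ := Finset.mem_image.1 hs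
      obtain ⟨b, hb, h⟩ := Finset.mem_image.1 hs'
      have := hBc b hb
      rw [h] at this
      simp [A] at this
    have hFFmax : ∀ E ∈ F.powerset, F ⊆ E → E = F := fun E hE h =>
      (Finset.mem_powerset.1 hE).antisymm h
    have hpair : ∀ G ∈ P', ({enc G, enc F} : Finset ℕ) ∈ sd F.powerset := fun G hG =>
      pair_mem_sd (by simpa using (hP'm G hG).1.2.1) (by simp) (hP'm G hG).1.1 hF0 (hP'm G hG).1.2.1
    have hsing : ∀ G ∈ P', ({enc G} : Finset ℕ) ∈ sd F.powerset := fun G hG =>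
      single_mem_sd (by simpa using (hP'm G hG).1.2.1) (hP'm G hG).1.1
    have hIsub : (sd (sd Δ)).filter (fun s => ¬ Disjoint s τ) ⊆
        sd (sd F.powerset) \ sd (sd (F.powerset.erase F)) := by
      intro s hs
      rw [Finset.mem_filter, Finset.not_disjoint_iff] at hs
      obtain ⟨h1, v, hv, hv'⟩ := hs
      obtain ⟨c, rfl⟩ := hτe v hv'
      exact interior_of_meets hmax h1 hv (hτF' c hv')
    have hAsub : P'.image A ⊆ sd (sd F.powerset) \ sd (sd (F.powerset.erase F)) := by
      intro s hs
      obtain ⟨G, hG, rfl⟩ := Finset.mem_image.1 hs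
      refine interior_of_meets hFFmax (single_mem_sd (hpair G hG) (by simp))
        (c := {enc G, enc F}) (by simp [A]) (by simp)
    have hBsub : P'.image B ⊆ sd (sd F.powerset) \ sd (sd (F.powerset.erase F)) := by
      intro s hs
      obtain ⟨G, hG, rfl⟩ := Finset.mem_image.1 hs
      refine interior_of_meets hFFmax (pair_mem_sd (hsing G hG) (hpair G hG) (by simp) (by simp)
        (by simp)) (c := {enc G, enc F}) (by simp [B]) (by simp)
    have hdisj : Disjoint ((sd (sd Δ)).filter (fun s => ¬ Disjoint s τ)) (P'.image A ∪ P'.image B) := by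
      rw [Finset.disjoint_left]
      intro s hs hs'
      refine (Finset.mem_filter.1 hs).2 ?_
      rcases Finset.mem_union.1 hs' with h | h
      · obtain ⟨G, hG, rfl⟩ := Finset.mem_image.1 h
        simpa [A] using (hP'm G hG).2
      · obtain ⟨G, hG, rfl⟩ := Finset.mem_image.1 h
        have h2 : enc {enc G} ∉ τ := fun h => by
          have := hτF' _ h
          rw [Finset.mem_singleton] at this
          exact (hP'm G hG).1.2.2.2 this.symm
        simp only [B, Finset.disjoint_insert_left, Finset.disjoint_singleton_left]
        exact ⟨h2, (hP'm G hG).2⟩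
    have hfin := Finset.card_le_card (Finset.union_subset hIsub (Finset.union_subset hAsub hBsub))
    rw [Finset.card_union_of_disjoint hdisj, Finset.card_union_of_disjoint hAB,
      Finset.card_image_of_injOn hAinj, Finset.card_image_of_injOn hBinj] at hfin
    have := pow_ge d hd
    omega
  · have hPc : (Finset.Ioo ∅ F).card = 2 ^ d - 2 := by
      rw [Finset.card_Ioo_finset (by simp), hFd]; simp
    have hinj : Function.Injective (fun G : Finset ℕ => ({enc {enc G}} : Finset ℕ)) := by
      intro a b h
      exact enc_inj (Finset.singleton_injective (enc_inj (Finset.singleton_injective h)))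
    rw [← hPc, ← Finset.card_image_of_injective _ hinj]
    apply Finset.card_le_card
    intro s hs
    obtain ⟨G, hG, rfl⟩ := Finset.mem_image.1 hs
    rw [Finset.mem_Ioo] at hG
    rw [Finset.mem_erase, Finset.mem_filter]
    refine ⟨by simp, single_mem_sd (single_mem_sd (hC F hF G hG.2.le) hG.1.ne') (by simp), ?_⟩
    rw [Finset.disjoint_singleton_left]
    intro h
    have := hτF' _ h
    rw [Finset.mem_singleton] at this
    exact hG.2.ne (enc_inj this).symm

end helpers7

section helpers8
open scoped Classical

variable {K : Type*} [Field K]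

lemma good_betti {Γ : SC} (hΓ : IsComplex Γ) {d : ℕ} {τ : Finset ℕ} (hτ : τ ∈ Γ)
    (hτd : τ.card = d) {j : ℕ} (hj : 1 ≤ j) {W0 : Finset (Finset ℕ)}
    (hW0 : W0 ⊆ Finset.Ioo ∅ (Finset.range d)) (hg : GoodW K j W0) (i : ℕ)
    (h1 : W0.card ≤ i + j)
    (h2 : i + j ≤ W0.card + ((Γ.filter (fun s => Disjoint s τ)).erase ∅).card) :
    bettiSR K (sd Γ) i (i + j) ≠ 0 := by
  obtain ⟨g, hgτ⟩ := exists_perm hτd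
  have hginj : Function.Injective (fun t : Finset ℕ => t.image g) := Finset.image_injective g.injective
  have hβ : Function.Injective (fun t : Finset ℕ => enc (t.image g)) := enc_inj.comp hginj
  obtain ⟨Y, hY, hYc⟩ := Finset.exists_subset_card_eq
    (show i + j - W0.card ≤ ((Γ.filter (fun s => Disjoint s τ)).erase ∅).card by omega)
  have hYm : ∀ u ∈ Y, u ≠ ∅ ∧ u ∈ Γ ∧ Disjoint u τ := by
    intro u hu
    have := hY hu
    rw [Finset.mem_erase, Finset.mem_filter] at this
    exact this
  have hWm : ∀ t ∈ W0, t.image g ≠ ∅ ∧ t.image g ⊆ τ := by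
    intro t ht
    have := Finset.mem_Ioo.1 (hW0 ht)
    refine ⟨by simpa using this.1.ne', ?_⟩
    rw [← hgτ]; exact Finset.image_subset_image this.2.le
  have hcon : ∀ u ∈ Y, ∀ t ∈ W0, ¬ (t.image g ⊆ u ∨ u ⊆ t.image g) := by
    intro u hu t ht h
    obtain ⟨a1, a2, a3⟩ := hYm u hu
    obtain ⟨b1, b2⟩ := hWm t ht
    rcases h with h | h
    · exact b1 (Finset.disjoint_self_iff_empty _ |>.1 (a3.mono h b2))
    · exact a1 (Finset.disjoint_self_iff_empty _ |>.1 (a3.mono le_rfl (h.trans b2)))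
  obtain ⟨z, hz, hzs, C0, hC0, hzC0, hmax⟩ := hg _ hβ
  have hdisj : Disjoint (W0.image (fun t : Finset ℕ => enc (t.image g))) (Y.image enc) := by
    rw [Finset.disjoint_left]
    intro v hv hv'
    obtain ⟨t, ht, rfl⟩ := Finset.mem_image.1 hv
    obtain ⟨u, hu, h⟩ := Finset.mem_image.1 hv'
    exact hcon u hu t ht (Or.inl (enc_inj h).ge)
  have himg : ∀ C : Finset (Finset ℕ), C.image (fun t : Finset ℕ => enc (t.image g)) =
      (C.image (fun t : Finset ℕ => t.image g)).image enc := by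
    intro C; rw [Finset.image_image]; rfl
  have hC0ne : C0.Nonempty := by
    obtain ⟨C, -, -, h3, h4⟩ := hzs _ hzC0
    rw [Finset.nonempty_iff_ne_empty]
    rintro rfl
    simp at h4; omega
  refine bettiSR_ne (W := W0.image (fun t : Finset ℕ => enc (t.image g)) ∪ Y.image enc) ?_ ?_ ?_
  · rw [vertexSet_sd, himg, ← Finset.image_union]
    apply Finset.image_subset_image
    intro s hs
    rw [Finset.mem_erase]
    rcases Finset.mem_union.1 hs with h | h
    · obtain ⟨t, ht, rfl⟩ := Finset.mem_image.1 h
      exact ⟨(hWm t ht).1, hΓ τ hτ _ (hWm t ht).2⟩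
    · exact ⟨(hYm s h).1, (hYm s h).2.1⟩
  · rw [Finset.card_union_of_disjoint hdisj, Finset.card_image_of_injective _ hβ,
      Finset.card_image_of_injective _ enc_inj, hYc]
    omega
  · refine HN_of_facet z hz ?_ _ hzC0 ?_
    · intro G hG
      obtain ⟨C, a1, a2, rfl, a4⟩ := hzs G hG
      refine ⟨?_, a4⟩
      unfold inducedSC
      rw [Finset.mem_filter]
      refine ⟨?_, (Finset.image_subset_image a1).trans Finset.subset_union_left⟩
      rw [himg]
      refine image_mem_sd.2 ⟨?_, ?_⟩
      · intro s hs
        obtain ⟨t, ht, rfl⟩ := Finset.mem_image.1 hs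
        exact ⟨hΓ τ hτ _ (hWm t (a1 ht)).2, (hWm t (a1 ht)).1⟩
      · intro s hs s' hs'
        obtain ⟨t, ht, rfl⟩ := Finset.mem_image.1 hs
        obtain ⟨t', ht', rfl⟩ := Finset.mem_image.1 hs'
        exact (a2 t ht t' ht').imp (fun h => Finset.image_subset_image h)
          (fun h => Finset.image_subset_image h)
    · intro v hv hmem
      unfold inducedSC at hmem
      rw [Finset.mem_filter] at hmem
      obtain ⟨m1, m2⟩ := hmem
      obtain ⟨C, c1, c2, c3⟩ := mem_sd.1 m1
      have hC0C : ∀ t ∈ C0, t.image g ∈ C := by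
        intro t ht
        rw [← enc_mem_image, ← c3]
        exact Finset.mem_insert_of_mem (Finset.mem_image_of_mem _ ht)
      have hvC : ∀ u, v = enc u → u ∈ C := by
        intro u hu
        rw [← enc_mem_image, ← c3, ← hu]; simp
      rcases Finset.mem_union.1 (m2 (Finset.mem_insert_self _ _)) with h | h
      · obtain ⟨t, ht, rfl⟩ := Finset.mem_image.1 h
        have htC0 : t ∉ C0 := fun h => hv (Finset.mem_image_of_mem _ h)
        obtain ⟨s, hs, hne⟩ := hmax t ht htC0
        apply hne
        have hi : ∀ a b : Finset ℕ, a.image g ⊆ b.image g → a ⊆ b := fun a b h =>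
          (Finset.image_subset_image_iff g.injective).1 h
        exact (c2 _ (hC0C s hs) _ (hvC _ rfl)).imp (hi _ _) (hi _ _)
      · obtain ⟨u, hu, rfl⟩ := Finset.mem_image.1 h
        obtain ⟨t, ht⟩ := hC0ne
        exact hcon u hu t (hC0 ht) (c2 _ (hC0C t ht) _ (hvC u rfl))

lemma count_aux (Γ : SC) (τ : Finset ℕ) :
    (Γ.erase ∅).card ≤ ((Γ.filter (fun s => Disjoint s τ)).erase ∅).card +
      (Γ.filter (fun s => ¬ Disjoint s τ)).card := by
  rw [← Finset.card_union_of_disjoint]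
  · apply Finset.card_le_card
    intro s hs
    rw [Finset.mem_erase] at hs
    rw [Finset.mem_union, Finset.mem_erase, Finset.mem_filter, Finset.mem_filter]
    by_cases h : Disjoint s τ
    · exact Or.inl ⟨hs.1, hs.2, h⟩
    · exact Or.inr ⟨hs.2, h⟩
  · rw [Finset.disjoint_left]
    intro s hs hs'
    rw [Finset.mem_erase, Finset.mem_filter] at hs
    rw [Finset.mem_filter] at hs'
    exact hs'.2 hs.2.2

lemma main_betti {Δ : SC} (hC : IsComplex Δ) {d : ℕ} (hd : 2 ≤ d) (hdim : Δ.sup Finset.card = d)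
    (r : ℕ) (hr : 3 ≤ r) {j : ℕ} (hj : 1 ≤ j) (hjd : j < d) (i : ℕ) (h1 : mj d j ≤ i)
    (h2 : (i : ℤ) + j ≤ (pdimSR K (sd^[r] Δ) : ℤ) + (depthSR K Δ : ℤ) - (Nd d : ℤ) +
      2 ^ d - 2 - (mj d (d - j - 1) + (d - j - 1 : ℕ))) :
    bettiSR K (sd^[r] Δ) i (i + j) ≠ 0 := by
  obtain ⟨n, rfl⟩ : ∃ n, r = n + 3 := ⟨r - 3, by omega⟩
  obtain ⟨hC', hdim'⟩ := iterate_sd hC (by omega) hdim n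
  have hit : sd^[n + 3] Δ = sd (sd (sd (sd^[n] Δ))) := by
    rw [Function.iterate_succ_apply', Function.iterate_succ_apply', Function.iterate_succ_apply']
  rw [hit] at h2 ⊢
  obtain ⟨τ, hτ, hτd, hI, hX⟩ := setup hC' hd hdim'
  obtain ⟨F, hF, hFd⟩ := exists_face (by omega) hdim
  have hdep := depth_le (K := K) Δ hC d hdim F hF hFd
  have hp := pdim_le (K := K) (sd (sd (sd (sd^[n] Δ))))
  rw [nverts_sd] at hp
  have hΓ : IsComplex (sd (sd (sd^[n] Δ))) := isComplex_sd _
  generalize sd (sd (sd^[n] Δ)) = Γ at *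
  have hcount := count_aux Γ τ
  obtain ⟨W1, a1, a2, a3⟩ := exists_good_min (K := K) hjd
  obtain ⟨W2, b1, b2, b3⟩ := exists_good_max (K := K) hjd
  have hpow := pow_ge d hd
  have hcast : ((2 ^ d : ℕ) : ℤ) = 2 ^ d := by push_cast; rfl
  by_cases hc : i + j ≤ W1.card + ((Γ.filter (fun s => Disjoint s τ)).erase ∅).card
  · exact good_betti hΓ hτ hτd hj a1 a2 i (by omega) hc
  · refine good_betti hΓ hτ hτd hj b1 b2 i (by omega) ?_
    rw [← hcast] at h2
    omega

end helpers8

/-- Nonvanishing ranges for the Betti numbers of iterated barycentric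
subdivisions `sd^r(Δ)`, `r ≥ 3`, of a `(d-1)`-dimensional complex `Δ`. -/
theorem statement_12 (K : Type*) [Field K] (d : ℕ) (hd : 2 ≤ d) (Δ : SC)
    (hC : IsComplex Δ) (hdim : Δ.sup Finset.card = d) (r : ℕ) (hr : 3 ≤ r) :
    (∀ j i : ℕ, 1 ≤ j → 2 * j ≤ d → j ≤ i →
      (i : ℤ) ≤ (pdimSR K (sd^[r] Δ) : ℤ) + (depthSR K Δ : ℤ) - (Nd d : ℤ) +
        2 ^ d - d - 1 - (mj d (d - j - 1) : ℤ) →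
      bettiSR K (sd^[r] Δ) i (i + j) ≠ 0) ∧
    (∀ j i : ℕ, d < 2 * j → j ≤ d - 2 → mj d j ≤ i →
      (i : ℤ) ≤ (pdimSR K (sd^[r] Δ) : ℤ) + (depthSR K Δ : ℤ) - (Nd d : ℤ) +
        2 ^ d - 2 * d + j →
      bettiSR K (sd^[r] Δ) i (i + j) ≠ 0) ∧
    (∀ i : ℕ, 2 ^ d - d - 1 ≤ i →
      (i : ℤ) ≤ (pdimSR K (sd^[r] Δ) : ℤ) + (depthSR K Δ : ℤ) - (Nd d : ℤ) +
        2 ^ d - d - 1 →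
      bettiSR K (sd^[r] Δ) i (i + (d - 1)) ≠ 0) := by
  refine ⟨?_, ?_, ?_⟩
  · intro j i hj hjd hi hu
    have e : mj d j = j := by unfold mj; rw [if_pos hjd]
    refine main_betti hC hd hdim r hr hj (by omega) i (by omega) ?_
    have e2 : ((d - j - 1 : ℕ) : ℤ) = d - j - 1 := by omega
    rw [e2]; linarith
  · intro j i hj hjd hi hu
    have e : mj d (d - j - 1) = d - j - 1 := by unfold mj; rw [if_pos (by omega)]
    refine main_betti hC hd hdim r hr (by omega) (by omega) i (by omega) ?_
    have e2 : ((d - j - 1 : ℕ) : ℤ) = d - j - 1 := by omega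
    rw [e, e2]; linarith
  · intro i hi hu
    have e : mj d (d - (d - 1) - 1) = d - (d - 1) - 1 := by unfold mj; rw [if_pos (by omega)]
    have e1 : mj d (d - 1) + (d - 1) = 2 ^ d - 2 := by
      have := mj_eq (d := d) (j := d - 1) (by omega)
      rw [show d - (d - 1) = 1 by omega, Nat.div_one, Nat.mod_one] at this
      omega
    refine main_betti hC hd hdim r hr (by omega) (by omega) i (by omega) ?_
    have e2 : ((d - (d - 1) - 1 : ℕ) : ℤ) = 0 := by omega
    have e3 : ((d - 1 : ℕ) : ℤ) = d - 1 := by omega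
    rw [e, e2, e3]; linarith
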